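/- arXiv:0812.0088 — 4 statements merged into one kernel-verified Lean document; each statement's English description precedes it below -/
import Mathlib

section
/- Let K be a field and let f_1,…,f_m be homogeneous polynomials in K[x_0,…,x_m] (m+1 variables) of degrees d_1,…,d_m ≥ 1 forming a regular sequence. Then for every integer d ≥ Σ_{i=1}^m (d_i − 1), the K-dimension of the degree-d homogeneous component of the graded quotient ring B = K[x_0,…,x_m]/⟨f_1,…,f_m⟩ equals Π_{i=1}^m d_i. In particular, the Hilbert function of B is constant on all degrees d ≥ Σ_{i=1}^m (d_i − 1). -/
open MvPolynomial

lemma Submodule.finrank_map_add_finrank_inf_ker {K V W : Type*} [Field K]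
    [AddCommGroup V] [Module K V]
    [AddCommGroup W] [Module K W] (p : Submodule K V) [Module.Finite K p] (g : V →ₗ[K] W) :
    Module.finrank K (p.map g) + Module.finrank K (p ⊓ LinearMap.ker g : Submodule K V) =
      Module.finrank K p := by
  have h := (g.domRestrict p).finrank_range_add_finrank_ker
  rwa [LinearMap.range_domRestrict, LinearMap.ker_domRestrict,
    ← Submodule.finrank_map_subtype_eq, Submodule.map_comap_subtype] at h

namespace MvPolynomial

section HilbertFunction

variable {σ K : Type*} [Field K]

lemma homogeneousSubmodule_eq_supported_finsuppAntidiag [Fintype σ] [DecidableEq σ] (d : ℕ) :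
    homogeneousSubmodule σ K d =
      AddMonoidAlgebra.supported K K (Finset.finsuppAntidiag (Finset.univ : Finset σ) d : Set _) := by
  rw [homogeneousSubmodule_eq_finsupp_supported]
  congr 1
  ext a
  simp [Finsupp.degree_eq_sum]

instance finite_homogeneousSubmodule [Finite σ] (d : ℕ) :
    Module.Finite K (homogeneousSubmodule σ K d) := by
  classical
  have := Fintype.ofFinite σ
  rw [homogeneousSubmodule_eq_supported_finsuppAntidiag]
  exact Module.Finite.equiv (AddMonoidAlgebra.supportedEquivFinsupp _).symm

lemma finrank_homogeneousSubmodule [Fintype σ] [Nonempty σ] (d : ℕ) :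
    Module.finrank K (homogeneousSubmodule σ K d) =
      (Fintype.card σ + d - 1).choose d := by
  classical
  rw [homogeneousSubmodule_eq_supported_finsuppAntidiag,
    (AddMonoidAlgebra.supportedEquivFinsupp _).finrank_eq, Module.finrank_finsupp_self]
  simp [Finset.card_finsuppAntidiag_nat_eq_choose]

/-- The degree-`d` homogeneous component of the quotient of a polynomial ring by an ideal. -/
noncomputable def quotientComponent (I : Ideal (MvPolynomial σ K)) (d : ℕ) :
    Submodule K (MvPolynomial σ K ⧸ I) :=
  (homogeneousSubmodule σ K d).map (Ideal.Quotient.mkₐ K I).toLinearMap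

instance [Finite σ] (I : Ideal (MvPolynomial σ K)) (d : ℕ) :
    Module.Finite K (quotientComponent I d) := by
  unfold quotientComponent
  infer_instance

/-- The generating function of the Hilbert function of the quotient by an ideal. -/
noncomputable def hilbertSeries (I : Ideal (MvPolynomial σ K)) : PowerSeries ℤ :=
  PowerSeries.mk fun d => (Module.finrank K (quotientComponent I d) : ℤ)

attribute [local instance] MvPolynomial.gradedAlgebra

lemma exists_homogeneous_mul_sub_mem {I : Ideal (MvPolynomial σ K)}
    (hI : I.IsHomogeneous (homogeneousSubmodule σ K)) {g a : MvPolynomial σ K} {e d : ℕ}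
    (hg : g.IsHomogeneous e) (ha : a.IsHomogeneous d) (haJ : a ∈ I ⊔ Ideal.span {g}) :
    a ∈ I ∨ e ≤ d ∧ ∃ r : MvPolynomial σ K, r.IsHomogeneous (d - e) ∧ a - g * r ∈ I := by
  obtain ⟨y, hy, z, hz, rfl⟩ := Submodule.mem_sup.mp haJ
  obtain ⟨r, rfl⟩ := Ideal.mem_span_singleton.mp hz
  have hyd := hI d hy
  have hsum : (DirectSum.decompose (homogeneousSubmodule σ K) (y + g * r) d : MvPolynomial σ K) =
      y + g * r := DirectSum.decompose_of_mem_same _ ha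
  rw [DirectSum.decompose_add, DirectSum.add_apply, Submodule.coe_add] at hsum
  by_cases hed : e ≤ d
  · rw [DirectSum.coe_decompose_mul_of_left_mem_of_le _ hg hed] at hsum
    refine Or.inr ⟨hed, _, (DirectSum.decompose (homogeneousSubmodule σ K) r (d - e)).2, ?_⟩
    rwa [← hsum, add_sub_cancel_right]
  · rw [DirectSum.coe_decompose_mul_of_left_mem_of_not_le _ hg hed, add_zero] at hsum
    rw [← hsum]
    exact Or.inl hyd

variable {I : Ideal (MvPolynomial σ K)} {g : MvPolynomial σ K} {e : ℕ}

lemma quotientComponent_inf_ker_factor (hI : I.IsHomogeneous (homogeneousSubmodule σ K))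
    (hg : g.IsHomogeneous e) (d : ℕ) :
    quotientComponent I d ⊓
        LinearMap.ker (Ideal.Quotient.factorₐ K (le_sup_left : I ≤ I ⊔ Ideal.span {g})).toLinearMap =
      if e ≤ d then
        (quotientComponent I (d - e)).map (LinearMap.mulLeft K (Ideal.Quotient.mk I g))
      else ⊥ := by
  apply le_antisymm
  · rintro _ ⟨⟨a, ha, rfl⟩, hker⟩
    have haJ : a ∈ I ⊔ Ideal.span {g} := Ideal.Quotient.eq_zero_iff_mem.mp hker
    rcases exists_homogeneous_mul_sub_mem hI hg ha haJ with h | ⟨hed, r, hr, h⟩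
    · have : (Ideal.Quotient.mkₐ K I).toLinearMap a = 0 := Ideal.Quotient.eq_zero_iff_mem.mpr h
      rw [this]
      exact zero_mem _
    · rw [if_pos hed]
      exact ⟨_, ⟨r, hr, rfl⟩, (Ideal.Quotient.eq.mpr h).symm⟩
  · split_ifs with hed
    · rintro _ ⟨_, ⟨r, hr, rfl⟩, rfl⟩
      refine ⟨⟨g * r, ?_, rfl⟩, ?_⟩
      · have := hg.mul hr
        rwa [Nat.add_sub_cancel' hed] at this
      · exact Ideal.Quotient.eq_zero_iff_mem.mpr
          (Ideal.mul_mem_right _ _ (Ideal.mem_sup_right (Ideal.mem_span_singleton_self g)))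
    · exact bot_le

lemma hilbertSeries_sup_span_singleton [Finite σ]
    (hI : I.IsHomogeneous (homogeneousSubmodule σ K)) (hg : g.IsHomogeneous e)
    (hreg : ∀ r, g * r ∈ I → r ∈ I) :
    hilbertSeries (I ⊔ Ideal.span {g}) = (1 - PowerSeries.X ^ e) * hilbertSeries I := by
  ext d
  have h := (quotientComponent I d).finrank_map_add_finrank_inf_ker
    (Ideal.Quotient.factorₐ K (le_sup_left : I ≤ I ⊔ Ideal.span {g})).toLinearMap
  have hmap : (quotientComponent I d).map
      (Ideal.Quotient.factorₐ K (le_sup_left : I ≤ I ⊔ Ideal.span {g})).toLinearMap =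
      quotientComponent (I ⊔ Ideal.span {g}) d :=
    (Submodule.map_comp _ _ _).symm
  have hinj : Function.Injective (LinearMap.mulLeft K (Ideal.Quotient.mk I g)) := by
    rw [← LinearMap.ker_eq_bot, LinearMap.ker_eq_bot']
    intro x hx
    obtain ⟨r, rfl⟩ := Ideal.Quotient.mk_surjective x
    exact Ideal.Quotient.eq_zero_iff_mem.mpr (hreg r (Ideal.Quotient.eq_zero_iff_mem.mp hx))
  rw [hmap, quotientComponent_inf_ker_factor hI hg] at h
  rw [sub_mul, one_mul, map_sub, PowerSeries.coeff_X_pow_mul']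
  simp only [hilbertSeries, PowerSeries.coeff_mk]
  by_cases hed : e ≤ d
  · rw [if_pos hed, ← (Submodule.equivMapOfInjective _ hinj _).finrank_eq] at h
    rw [if_pos hed, ← h]
    simp
  · rw [if_neg hed, finrank_bot] at h
    rw [if_neg hed, ← h]
    simp

lemma hilbertSeries_span_range_of_isWeaklyRegular [Finite σ] {n : ℕ}
    {f : Fin n → MvPolynomial σ K} {dd : Fin n → ℕ} (hhom : ∀ i, (f i).IsHomogeneous (dd i))
    (hreg : RingTheory.Sequence.IsWeaklyRegular (MvPolynomial σ K) (List.ofFn f)) :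
    hilbertSeries (Ideal.span (Set.range f)) =
      (∏ i, (1 - PowerSeries.X ^ dd i)) * hilbertSeries (⊥ : Ideal (MvPolynomial σ K)) := by
  induction n with
  | zero => simp
  | succ n ih =>
    rw [List.ofFn_succ', List.concat_eq_append,
      RingTheory.Sequence.isWeaklyRegular_append_iff,
      RingTheory.Sequence.isWeaklyRegular_singleton_iff] at hreg
    obtain ⟨hinit, hlast⟩ := hreg
    have hspan : Ideal.ofList (List.ofFn fun i : Fin n => f i.castSucc) =
        Ideal.span (Set.range fun i : Fin n => f i.castSucc) := by
      simp [Ideal.ofList, Set.range, List.mem_ofFn]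
    have hrange : Ideal.span (Set.range f) =
        Ideal.span (Set.range fun i : Fin n => f i.castSucc) ⊔ Ideal.span {f (Fin.last n)} := by
      rw [← Ideal.span_union]
      congr 1
      ext x
      simp [Fin.exists_fin_succ', or_comm, eq_comm]
    rw [hrange, hilbertSeries_sup_span_singleton _ (hhom _), ih (fun i => hhom _) hinit,
      Fin.prod_univ_castSucc]
    · ring
    · intro r hr
      rw [hspan, smul_eq_mul, Ideal.mul_top] at hlast
      refine Ideal.Quotient.eq_zero_iff_mem.mp (hlast.right_eq_zero_of_smul ?_)
      exact Ideal.Quotient.eq_zero_iff_mem.mpr hr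
    · refine Ideal.homogeneous_span _ _ ?_
      rintro _ ⟨i, rfl⟩
      exact ⟨_, hhom _⟩

lemma hilbertSeries_bot (m : ℕ) :
    hilbertSeries (⊥ : Ideal (MvPolynomial (Fin (m + 1)) K)) =
      (PowerSeries.invOneSubPow ℤ (m + 1)).val := by
  ext d
  rw [PowerSeries.invOneSubPow_val_succ_eq_mk_add_choose]
  have hinj : Function.Injective (Ideal.Quotient.mkₐ K
      (⊥ : Ideal (MvPolynomial (Fin (m + 1)) K))).toLinearMap := by
    rw [← LinearMap.ker_eq_bot, LinearMap.ker_eq_bot']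
    intro x hx
    exact Ideal.Quotient.eq_zero_iff_mem.mp hx
  have hfin : Module.finrank K (quotientComponent (⊥ : Ideal (MvPolynomial (Fin (m + 1)) K)) d) =
      Module.finrank K (homogeneousSubmodule (Fin (m + 1)) K d) :=
    (Submodule.equivMapOfInjective _ hinj _).finrank_eq.symm
  simp only [hilbertSeries, PowerSeries.coeff_mk]
  rw [hfin, finrank_homogeneousSubmodule, Fintype.card_fin, Nat.add_right_comm, Nat.add_sub_cancel,
    Nat.choose_symm_add]

end HilbertFunction

end MvPolynomial

lemma PowerSeries.coeff_prod_geom_mul_mk_one {R ι : Type*} [CommRing R] (s : Finset ι) (e : ι → ℕ)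
    {d : ℕ} (hd : ∑ i ∈ s, (e i - 1) ≤ d) :
    coeff d ((∏ i ∈ s, ∑ j ∈ Finset.range (e i), (X : PowerSeries R) ^ j) * mk 1) =
      ∏ i ∈ s, (e i : R) := by
  classical
  induction s using Finset.induction_on generalizing d with
  | empty => simp
  | insert a s ha ih =>
    rw [Finset.sum_insert ha] at hd
    rw [Finset.prod_insert ha, Finset.prod_insert ha, mul_assoc, Finset.sum_mul, map_sum,
      Finset.sum_congr rfl (g := fun _ => ∏ i ∈ s, (e i : R))]
    · simp
    · intro j hj
      have hj := Finset.mem_range.mp hj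
      rw [coeff_X_pow_mul', if_pos (by omega),
        ih (by omega)]

lemma PowerSeries.prod_one_sub_X_pow_mul_invOneSubPow {R : Type*} [CommRing R] {m : ℕ}
    (e : Fin m → ℕ) :
    (∏ i, (1 - X ^ e i)) * (invOneSubPow R (m + 1)).val =
      (∏ i, ∑ j ∈ Finset.range (e i), (X : PowerSeries R) ^ j) * mk 1 := by
  have h : ∀ i, (1 - X ^ e i : PowerSeries R) =
      (∑ j ∈ Finset.range (e i), X ^ j) * (1 - X) := fun i => (geom_sum_mul_neg _ _).symm
  simp_rw [h]
  rw [Finset.prod_mul_distrib, Finset.prod_const, Finset.card_univ, Fintype.card_fin, mul_assoc,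
    add_comm m 1, one_sub_pow_mul_invOneSubPow_val_add_eq_invOneSubPow_val]
  congr 1
  ext
  simp [invOneSubPow_val_succ_eq_mk_add_choose R 0]

/-- Let `K` be a field and `f₁, …, f_m` homogeneous polynomials
in `K[x₀, …, x_m]` (`m + 1` variables) of degrees `d₁, …, d_m ≥ 1` forming a
regular sequence.  Then for every `d ≥ ∑ i (dᵢ - 1)`, the `K`-dimension of the
degree-`d` homogeneous component of `B = K[x₀, …, x_m]/⟨f₁, …, f_m⟩` (the image
of the degree-`d` homogeneous polynomials under the quotient map) equals
`∏ i, dᵢ`.  In particular the Hilbert function of `B` is constant in degrees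
`≥ ∑ i (dᵢ - 1)`. -/
theorem stmt0 {K : Type*} [Field K] (m : ℕ)
    (f : Fin m → MvPolynomial (Fin (m + 1)) K) (dd : Fin m → ℕ)
    (hd : ∀ i, 1 ≤ dd i)
    (hhom : ∀ i, (f i).IsHomogeneous (dd i))
    (hreg : RingTheory.Sequence.IsRegular (MvPolynomial (Fin (m + 1)) K)
      (List.ofFn f))
    (d : ℕ) (hdelta : ∑ i, (dd i - 1) ≤ d) :
    Module.finrank K
        ((homogeneousSubmodule (Fin (m + 1)) K d).map
          (Ideal.Quotient.mkₐ K (Ideal.span (Set.range f))).toLinearMap)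
      = ∏ i, dd i := by
  have hcoeff : (Module.finrank K (quotientComponent (Ideal.span (Set.range f)) d) : ℤ) =
      PowerSeries.coeff d (hilbertSeries (Ideal.span (Set.range f))) := by
    simp [hilbertSeries]
  rw [hilbertSeries_span_range_of_isWeaklyRegular hhom hreg.toIsWeaklyRegular, hilbertSeries_bot,
    PowerSeries.prod_one_sub_X_pow_mul_invOneSubPow,
    PowerSeries.coeff_prod_geom_mul_mk_one _ _ hdelta] at hcoeff
  exact_mod_cast hcoeff
end

section
/- Let K be an algebraically closed field and let f_1,…,f_m ∈ K[x_1,…,x_m] have total degrees d_1,…,d_m ≥ 1, and assume the leading forms of f_1,…,f_m have no common zero in K^m other than the origin. Set δ = Σ_{i=1}^m (d_i − 1). Then for every d ≥ δ, the K-dimension of the quotient K[x]_{≤d}/⟨f⟩_d equals Π_{i=1}^m d_i, which also equals dim_K K[x_1,…,x_m]/⟨f_1,…,f_m⟩. -/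
open MvPolynomial

section RegularSequences

variable {R : Type*} [CommRing R]

/-- A list is a (weakly) regular sequence modulo the ideal `I`. -/
def IsRegularModulo : Ideal R → List R → Prop
  | _, [] => True
  | I, a :: l => (∀ p, a * p ∈ I → p ∈ I) ∧ IsRegularModulo (I ⊔ Ideal.span {a}) l

theorem mem_sup_span_singleton_iff {I : Ideal R} {a x : R} :
    x ∈ I ⊔ Ideal.span {a} ↔ ∃ j ∈ I, ∃ r, x = j + a * r := by
  simp only [Submodule.mem_sup, Ideal.mem_span_singleton']
  constructor
  · rintro ⟨j, hj, _, ⟨r, rfl⟩, rfl⟩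
    exact ⟨j, hj, r, by ring⟩
  · rintro ⟨j, hj, r, rfl⟩
    exact ⟨j, hj, _, ⟨r, rfl⟩, by ring⟩

theorem isRegularModulo_append {I : Ideal R} {l l' : List R} :
    IsRegularModulo I (l ++ l') ↔
      IsRegularModulo I l ∧ IsRegularModulo (I ⊔ Ideal.ofList l) l' := by
  induction l generalizing I with
  | nil => simp [IsRegularModulo]
  | cons a l ih => simp [IsRegularModulo, ih, and_assoc, sup_assoc]

theorem IsRegularModulo.map_congr {ι : Type*} {I : Ideal R} {l : List ι} {u w : ι → R}
    (h : IsRegularModulo I (l.map u)) (huw : ∀ i ∈ l, u i - w i ∈ I) :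
    IsRegularModulo I (l.map w) := by
  induction l generalizing I with
  | nil => trivial
  | cons i l ih =>
    have hi : u i - w i ∈ I := huw i (by simp)
    have hsup : I ⊔ Ideal.span {w i} = I ⊔ Ideal.span {u i} := by
      ext x
      simp only [mem_sup_span_singleton_iff]
      constructor
      · rintro ⟨j, hj, r, rfl⟩
        exact ⟨j - (u i - w i) * r, I.sub_mem hj (I.mul_mem_right _ hi), r, by ring⟩
      · rintro ⟨j, hj, r, rfl⟩
        exact ⟨j + (u i - w i) * r, I.add_mem hj (I.mul_mem_right _ hi), r, by ring⟩
    simp only [List.map_cons, IsRegularModulo] at h ⊢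
    refine ⟨fun p hp ↦ h.1 p ?_, ?_⟩
    · have := I.add_mem hp (I.mul_mem_right p hi)
      convert this using 1
      ring
    · rw [hsup]
      exact ih h.2 fun k hk ↦ Ideal.mem_sup_left (huw k (by simp [hk]))

end RegularSequences

section Graded

variable {σ K : Type*} [Field K]

attribute [local instance] MvPolynomial.gradedAlgebra

theorem homogeneousComponent_mul_of_le {g : MvPolynomial σ K} {d n : ℕ} (hg : g.IsHomogeneous d)
    (h : d ≤ n) (p : MvPolynomial σ K) :
    homogeneousComponent n (g * p) = g * homogeneousComponent (n - d) p := by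
  have := DirectSum.coe_decompose_mul_of_left_mem_of_le (homogeneousSubmodule σ K)
    (b := p) hg h
  simpa only [DirectSum.decompose, Equiv.coe_fn_mk, decomposition.decompose'_apply] using this

theorem homogeneousComponent_mul_of_lt {g : MvPolynomial σ K} {d n : ℕ} (hg : g.IsHomogeneous d)
    (h : n < d) (p : MvPolynomial σ K) :
    homogeneousComponent n (g * p) = 0 := by
  have := DirectSum.coe_decompose_mul_of_left_mem_of_not_le (homogeneousSubmodule σ K)
    (b := p) hg h.not_ge
  simpa only [DirectSum.decompose, Equiv.coe_fn_mk, decomposition.decompose'_apply] using this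

theorem mem_of_forall_homogeneousComponent_mem {I : Ideal (MvPolynomial σ K)}
    {p : MvPolynomial σ K} (h : ∀ n ≤ p.totalDegree, homogeneousComponent n p ∈ I) : p ∈ I := by
  rw [← sum_homogeneousComponent p]
  exact I.sum_mem fun n hn ↦ h n (by simpa [Nat.lt_succ_iff] using hn)

/-- Homogeneous of some positive degree. -/
def IsPosHomogeneous (a : MvPolynomial σ K) : Prop := ∃ d, 0 < d ∧ a.IsHomogeneous d

theorem isHomogeneous_sup_span_singleton {I : Ideal (MvPolynomial σ K)}
    (hI : I.IsHomogeneous (homogeneousSubmodule σ K)) {a : MvPolynomial σ K}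
    (ha : IsPosHomogeneous a) :
    (I ⊔ Ideal.span {a}).IsHomogeneous (homogeneousSubmodule σ K) := by
  refine hI.sup (Ideal.homogeneous_span _ _ ?_)
  rintro x rfl
  obtain ⟨d, -, hd⟩ := ha
  exact ⟨d, hd⟩

theorem isRegularModulo_swap {I : Ideal (MvPolynomial σ K)}
    (hI : I.IsHomogeneous (homogeneousSubmodule σ K)) {a b : MvPolynomial σ K}
    (ha : IsPosHomogeneous a) (h : IsRegularModulo I [a, b]) : IsRegularModulo I [b, a] := by
  obtain ⟨h₁, h₂, -⟩ := h
  have key : ∀ n p, b * p ∈ I → ∃ r, p - a ^ n * r ∈ I ∧ b * r ∈ I := by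
    intro n p hp
    induction n with
    | zero => exact ⟨p, by simp, hp⟩
    | succ n ih =>
      obtain ⟨r, hr, hbr⟩ := ih
      obtain ⟨j, hj, s, rfl⟩ := mem_sup_span_singleton_iff.1 (h₂ r (Ideal.mem_sup_left hbr))
      refine ⟨s, ?_, h₁ _ ?_⟩
      · have := I.add_mem hr (I.mul_mem_left (a ^ n) hj)
        convert this using 1
        ring
      · have := I.sub_mem hbr (I.mul_mem_left b hj)
        convert this using 1
        ring
  refine ⟨fun p hp ↦ mem_of_forall_homogeneousComponent_mem fun k hk ↦ ?_, fun p hp ↦ ?_, trivial⟩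
  · obtain ⟨d, hd, had⟩ := ha
    obtain ⟨r, hr, -⟩ := key (p.totalDegree + 1) p hp
    have := homogeneousComponent_mem_of_mem hI hr k
    rwa [map_sub, homogeneousComponent_mul_of_lt (had.pow _) (by nlinarith), sub_zero] at this
  · obtain ⟨j, hj, q, hq⟩ := mem_sup_span_singleton_iff.1 hp
    have hq' : b * q ∈ I ⊔ Ideal.span {a} :=
      mem_sup_span_singleton_iff.2 ⟨-j, I.neg_mem hj, p, by rw [hq]; ring⟩
    obtain ⟨j', hj', q', rfl⟩ := mem_sup_span_singleton_iff.1 (h₂ q hq')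
    refine mem_sup_span_singleton_iff.2 ⟨p - b * q', h₁ _ ?_, q', by ring⟩
    have : a * (p - b * q') = j + b * j' := by rw [mul_sub, hq]; ring
    rw [this]
    exact I.add_mem hj (I.mul_mem_left b hj')

theorem IsRegularModulo.perm {l l' : List (MvPolynomial σ K)} (hl : l.Perm l')
    {I : Ideal (MvPolynomial σ K)} (hI : I.IsHomogeneous (homogeneousSubmodule σ K))
    (hpos : ∀ a ∈ l, IsPosHomogeneous a) (h : IsRegularModulo I l) : IsRegularModulo I l' := by
  induction hl generalizing I with
  | nil => trivial
  | cons a _ ih =>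
    exact ⟨h.1, ih (isHomogeneous_sup_span_singleton hI (hpos a (by simp)))
      (fun b hb ↦ hpos b (by simp [hb])) h.2⟩
  | swap a b l =>
    have := isRegularModulo_swap hI (hpos b (by simp)) ⟨h.1, h.2.1, trivial⟩
    refine ⟨this.1, this.2.1, ?_⟩
    rw [sup_right_comm]
    exact h.2.2
  | trans h₁ _ ih₁ ih₂ =>
    exact ih₂ hI (fun a ha ↦ hpos a (h₁.mem_iff.2 ha)) (ih₁ hI hpos h)

theorem mul_pow_mem_imp {R : Type*} [CommRing R] {I : Ideal R} {t : R}
    (h : ∀ p, t * p ∈ I → p ∈ I) (n : ℕ) (p : R) (hp : t ^ n * p ∈ I) : p ∈ I := by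
  induction n with
  | zero => simpa using hp
  | succ n ih => exact ih (h _ (by rwa [pow_succ', mul_assoc] at hp))

theorem aeval_C_mul_eq {τ : Type*} {c : MvPolynomial τ K} {N : ℕ} (hc : c.IsHomogeneous N)
    (v : τ → K) (t : MvPolynomial σ K) :
    aeval (fun i ↦ C (v i) * t) c = C (eval v c) * t ^ N := by
  rw [aeval_def, eval₂_eq, eval_eq, map_sum, Finset.sum_mul]
  refine Finset.sum_congr rfl fun s hs ↦ ?_
  have hdeg : s.degree = N := by
    by_contra hne
    exact (mem_support_iff.1 hs) (hc.coeff_eq_zero hne)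
  simp only [mul_pow, Finset.prod_mul_distrib, Finset.prod_pow_eq_pow_sum, map_mul, map_prod,
    map_pow, algebraMap_eq]
  rw [← hdeg, Finsupp.degree_apply, mul_assoc]

theorem homogeneousComponent_aeval_linear {τ : Type*} {b : τ → MvPolynomial σ K}
    (hb : ∀ i, (b i).IsHomogeneous 1) (c : MvPolynomial τ K) (e : ℕ) :
    homogeneousComponent e (aeval b c) = aeval b (homogeneousComponent e c) := by
  have hhom : ∀ i, (aeval b (homogeneousComponent i c)).IsHomogeneous i := fun i ↦ by
    simpa using (homogeneousComponent_isHomogeneous i c).aeval b hb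
  conv_lhs => rw [← sum_homogeneousComponent c]
  simp only [map_sum, homogeneousComponent_of_mem (hhom _)]
  rw [Finset.sum_ite_eq]
  split_ifs with h
  · rfl
  · rw [homogeneousComponent_eq_zero, map_zero]
    simpa using h

/-- Exchange lemma: a form `g` modulo which the linear forms `b` become algebraically dependent
can replace one of them in a regular sequence. -/
theorem IsRegularModulo.exists_exchange [Infinite K] {n : ℕ} {I : Ideal (MvPolynomial σ K)}
    (hI : I.IsHomogeneous (homogeneousSubmodule σ K)) {b : Fin (n + 1) → MvPolynomial σ K}
    (hb : ∀ i, (b i).IsHomogeneous 1) (hreg : IsRegularModulo I ((List.finRange (n + 1)).map b))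
    {g : MvPolynomial σ K} (hg : IsPosHomogeneous g) {c : MvPolynomial (Fin (n + 1)) K}
    (hc : c ≠ 0) (hcg : aeval b c ∈ I ⊔ Ideal.span {g}) :
    ∃ b' : Fin n → MvPolynomial σ K, (∀ i, (b' i).IsHomogeneous 1) ∧
      IsRegularModulo I (g :: (List.finRange n).map b') := by
  obtain ⟨e, he⟩ : ∃ e, homogeneousComponent e c ≠ 0 := by
    by_contra! h
    exact hc (by rw [← sum_homogeneousComponent c]; simp [h])
  set c' := homogeneousComponent e c * X 0 with hc'
  have hc'0 : c' ≠ 0 := mul_ne_zero he (X_ne_zero 0)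
  have hc'hom : c'.IsHomogeneous (e + 1) :=
    (homogeneousComponent_isHomogeneous e c).mul (isHomogeneous_X K 0)
  have hc'g : aeval b c' ∈ I ⊔ Ideal.span {g} := by
    rw [hc', map_mul, ← homogeneousComponent_aeval_linear hb]
    exact Ideal.mul_mem_right _ _
      (homogeneousComponent_mem_of_mem (isHomogeneous_sup_span_singleton hI hg) hcg e)
  obtain ⟨v, hv⟩ : ∃ v, eval v c' ≠ 0 := by
    by_contra! h
    exact hc'0 (MvPolynomial.funext fun x ↦ by simp [h])
  have hv0 : v 0 ≠ 0 := fun h ↦ hv (by simp [hc', h])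
  set t : MvPolynomial σ K := C (v 0)⁻¹ * b 0 with ht
  have htb : C (v 0) * t = b 0 := by
    rw [ht, ← mul_assoc, ← C_mul, mul_inv_cancel₀ hv0, C_1, one_mul]
  have htlin : t.IsHomogeneous 1 := (hb 0).C_mul _
  refine ⟨fun i ↦ b i.succ - C (v i.succ) * t, fun i ↦ (hb _).sub (htlin.C_mul _), ?_⟩
  set b' : Fin n → MvPolynomial σ K := fun i ↦ b i.succ - C (v i.succ) * t with hb'
  have hpos' : ∀ a ∈ (List.finRange n).map b', IsPosHomogeneous a := by
    simp only [List.mem_map]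
    rintro a ⟨i, -, rfl⟩
    exact ⟨1, one_pos, (hb _).sub (htlin.C_mul _)⟩
  have h₁ : IsRegularModulo I (b 0 :: (List.finRange n).map b') := by
    rw [List.finRange_succ, List.map_cons, List.map_map] at hreg
    refine ⟨hreg.1, hreg.2.map_congr fun i _ ↦ Ideal.mem_sup_right ?_⟩
    rw [Ideal.mem_span_singleton]
    exact ⟨C (v i.succ) * C (v 0)⁻¹, by simp only [hb', ht, Function.comp]; ring⟩
  have h₂ : IsRegularModulo I ((List.finRange n).map b' ++ [b 0]) := by
    refine h₁.perm (List.perm_append_singleton _ _).symm hI ?_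
    simp only [List.mem_cons]
    rintro a (rfl | ha)
    exacts [⟨1, one_pos, hb 0⟩, hpos' a ha]
  rw [isRegularModulo_append] at h₂
  set J := I ⊔ Ideal.ofList ((List.finRange n).map b') with hJ
  have htreg : ∀ p, t * p ∈ J → p ∈ J := fun p hp ↦ h₂.2.1 p (by
    rw [← htb, mul_assoc]
    exact J.mul_mem_left _ hp)
  have hbmem : ∀ i, b i - C (v i) * t ∈ J := by
    intro i
    refine Fin.cases ?_ (fun i ↦ ?_) i
    · simp [htb]
    · exact Ideal.mem_sup_right (Ideal.subset_span (List.mem_map.2 ⟨i, List.mem_finRange i, rfl⟩))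
  have hpow : t ^ (e + 1) ∈ J ⊔ Ideal.span {g} := by
    have h₃ : aeval b c' - aeval (fun i ↦ C (v i) * t) c' ∈ J := by
      rw [← Ideal.Quotient.eq, ← Ideal.Quotient.mkₐ_eq_mk K, ← AlgHom.comp_apply,
        ← AlgHom.comp_apply]
      congr 1
      ext i
      simpa using Ideal.Quotient.eq.2 (hbmem i)
    rw [aeval_C_mul_eq hc'hom] at h₃
    have h₄ : C (eval v c') * t ^ (e + 1) ∈ J ⊔ Ideal.span {g} := by
      have := Ideal.sub_mem _ ((sup_le_sup_right (le_sup_left : I ≤ J) _) hc'g)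
        (Ideal.mem_sup_left h₃)
      simpa using this
    have := Ideal.mul_mem_left _ (C (eval v c')⁻¹) h₄
    rwa [← mul_assoc, ← C_mul, inv_mul_cancel₀ hv, C_1, one_mul] at this
  obtain ⟨j, hj, r, hr⟩ := mem_sup_span_singleton_iff.1 hpow
  have h₅ : IsRegularModulo I ((List.finRange n).map b' ++ [g]) := by
    refine isRegularModulo_append.2 ⟨h₂.1, fun p hp ↦ mul_pow_mem_imp htreg (e + 1) p ?_, trivial⟩
    rw [hr, show (j + g * r) * p = j * p + r * (g * p) by ring]
    exact J.add_mem (J.mul_mem_right _ hj) (J.mul_mem_left _ hp)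
  refine h₅.perm (List.perm_append_singleton _ _) hI ?_
  simp only [List.mem_append, List.mem_singleton]
  rintro a (ha | rfl)
  exacts [hpos' a ha, hg]

theorem exists_aeval_mem_of_pow_idealOfVars_le [Finite σ] {n D : ℕ} {J : Ideal (MvPolynomial σ K)}
    (hJ : J.IsHomogeneous (homogeneousSubmodule σ K)) {l : List (MvPolynomial σ K)}
    (hl : ∀ a ∈ l, IsPosHomogeneous a) (hln : l.length ≤ n)
    (hD : idealOfVars σ K ^ D ≤ J ⊔ Ideal.ofList l) (b : Fin (n + 1) → MvPolynomial σ K) :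
    ∃ c : MvPolynomial (Fin (n + 1)) K, c ≠ 0 ∧ aeval b c ∈ J := by
  classical
  by_contra! hne
  obtain ⟨P, hP, hJP, hdisj⟩ := Ideal.exists_le_prime_disjoint J
    ((nonZeroDivisors (MvPolynomial (Fin (n + 1)) K)).map (aeval (R := K) b)) (by
      rw [Set.disjoint_left]
      rintro _ hx ⟨c, hc, rfl⟩
      exact hne c (nonZeroDivisors.ne_zero hc) hx)
  let φ := Ideal.Quotient.mkₐ K P
  have hφJ : ∀ j ∈ J, φ j = 0 := fun j hj ↦ Ideal.Quotient.eq_zero_iff_mem.2 (hJP hj)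
  have hind : AlgebraicIndependent K fun i ↦ φ (b i) := by
    rw [algebraicIndependent_iff]
    intro c hc
    by_contra hc0
    have : φ (aeval b c) = 0 := by
      rw [← hc, ← AlgHom.comp_apply]
      congr 1
      ext i
      simp
    exact Set.disjoint_left.1 hdisj (Ideal.Quotient.eq_zero_iff_mem.1 this)
      ⟨c, mem_nonZeroDivisors_of_ne_zero hc0, rfl⟩
  set s : Set (MvPolynomial σ K ⧸ P) := φ '' {a | a ∈ l} with hs
  let B := Algebra.adjoin K s
  let T : Set (MvPolynomial σ K ⧸ P) := (fun u ↦ φ (monomial u 1)) '' {u | u.degree ≤ D}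
  let M : Submodule B (MvPolynomial σ K ⧸ P) := Submodule.span B T
  have hsmul : ∀ (k : K) x, x ∈ M → k • x ∈ M := fun k x hx ↦ by
    have := M.smul_mem (algebraMap K B k) hx
    rwa [algebraMap_smul] at this
  have hgen : ∀ e, ∀ p : MvPolynomial σ K, p.IsHomogeneous e → φ p ∈ M := by
    intro e
    induction e using Nat.strong_induction_on with
    | _ e ih =>
    intro p hp
    by_cases heD : e ≤ D
    · rw [p.as_sum, map_sum]
      refine M.sum_mem fun u hu ↦ ?_
      have hu' : u.degree = e := by
        by_contra hne
        exact (mem_support_iff.1 hu) (hp.coeff_eq_zero hne)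
      have : monomial u (coeff u p) = coeff u p • monomial u (1 : K) := by simp [smul_monomial]
      rw [this, map_smul]
      exact hsmul _ _ (Submodule.subset_span ⟨u, by simp [hu', heD], rfl⟩)
    · have hpmem : p ∈ J ⊔ Ideal.ofList l := by
        refine hD ((mem_pow_idealOfVars_iff' D p).2 fun u hu ↦ hp.coeff_eq_zero ?_)
        lia
      obtain ⟨j, hj, q, hq, rfl⟩ := Submodule.mem_sup.1 hpmem
      rw [← homogeneousComponent_eq_self hp, map_add, map_add,
        hφJ _ (homogeneousComponent_mem_of_mem hJ hj e), zero_add]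
      suffices ∀ a, φ (homogeneousComponent e (a * q)) ∈ M by simpa using this 1
      refine Submodule.span_induction (p := fun q _ ↦ ∀ a, φ (homogeneousComponent e (a * q)) ∈ M)
        ?_ ?_ ?_ ?_ hq
      · intro g hg a
        obtain ⟨d, hd, hgd⟩ := hl g hg
        rw [mul_comm]
        by_cases hde : d ≤ e
        · rw [homogeneousComponent_mul_of_le hgd hde, map_mul]
          have := M.smul_mem (⟨φ g, Algebra.subset_adjoin ⟨g, hg, rfl⟩⟩ : B)
            (ih (e - d) (by lia) _ (homogeneousComponent_isHomogeneous (e - d) a))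
          rwa [Subalgebra.smul_def, smul_eq_mul] at this
        · rw [homogeneousComponent_mul_of_lt hgd (by lia), map_zero]
          exact M.zero_mem
      · simp
      · intro x y _ _ hx hy a
        rw [mul_add, map_add, map_add]
        exact M.add_mem (hx a) (hy a)
      · intro r x _ hx a
        rw [smul_eq_mul, ← mul_assoc]
        exact hx _
  have hfin : Module.Finite B (MvPolynomial σ K ⧸ P) := by
    refine ⟨Submodule.fg_def.2 ⟨T, (Finsupp.finite_of_degree_le D).image _, ?_⟩⟩
    rw [eq_top_iff]
    rintro x -
    obtain ⟨p, rfl⟩ := Ideal.Quotient.mkₐ_surjective K P x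
    rw [← sum_homogeneousComponent p, map_sum]
    exact M.sum_mem fun e _ ↦ hgen e _ (homogeneousComponent_isHomogeneous e p)
  have halg : Algebra.IsAlgebraic B (MvPolynomial σ K ⧸ P) := inferInstance
  have h₁ := hind.lift_cardinalMk_le_trdeg
  have h₂ : Algebra.trdeg K (MvPolynomial σ K ⧸ P) ≤ n := by
    refine (Algebra.IsAlgebraic.trdeg_le_cardinalMk K s).trans ?_
    have hsl : s = ↑(l.map φ).toFinset := by ext; simp [hs]
    rw [hsl, Finset.coe_sort_coe, Cardinal.mk_coe_finset]
    exact_mod_cast (List.toFinset_card_le _).trans (by simpa using hln)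
  have h₃ := h₁.trans (Cardinal.lift_le.2 h₂)
  simp only [Cardinal.mk_fin, Cardinal.lift_natCast] at h₃
  have := Nat.cast_le.1 h₃
  lia

theorem isRegularModulo_of_pow_idealOfVars_le [Finite σ] [Infinite K] {D : ℕ}
    {l : List (MvPolynomial σ K)} {I : Ideal (MvPolynomial σ K)}
    (hI : I.IsHomogeneous (homogeneousSubmodule σ K)) (hl : ∀ a ∈ l, IsPosHomogeneous a)
    (hD : idealOfVars σ K ^ D ≤ I ⊔ Ideal.ofList l) {b : Fin l.length → MvPolynomial σ K}
    (hb : ∀ i, (b i).IsHomogeneous 1)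
    (hreg : IsRegularModulo I ((List.finRange l.length).map b)) : IsRegularModulo I l := by
  induction l generalizing I with
  | nil => trivial
  | cons g l ih =>
    have hg : IsPosHomogeneous g := hl g (by simp)
    have hl' : ∀ a ∈ l, IsPosHomogeneous a := fun a ha ↦ hl a (by simp [ha])
    rw [Ideal.ofList_cons, ← sup_assoc] at hD
    have hI' := isHomogeneous_sup_span_singleton hI hg
    obtain ⟨c, hc, hcg⟩ := exists_aeval_mem_of_pow_idealOfVars_le hI' hl' le_rfl hD b
    obtain ⟨b', hb', h⟩ := hreg.exists_exchange hI hb hg hc hcg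
    exact ⟨h.1, ih hI' hl' hD hb' h.2⟩

theorem isRegularModulo_map_X {L : List σ} (hL : L.Nodup) (s : Set σ) (hs : ∀ i ∈ L, i ∉ s) :
    IsRegularModulo (Ideal.span (X '' s : Set (MvPolynomial σ K))) (L.map X) := by
  induction L generalizing s with
  | nil => trivial
  | cons i L ih =>
    refine ⟨fun p hp ↦ ?_, ?_⟩
    · rw [mem_ideal_span_X_image] at hp ⊢
      intro u hu
      obtain ⟨k, hk, hk'⟩ := hp (Finsupp.single i 1 + u) (by
        rw [mem_support_iff, coeff_X_mul]
        exact mem_support_iff.1 hu)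
      have hik : i ≠ k := fun h ↦ hs i (by simp) (h ▸ hk)
      exact ⟨k, hk, by simpa [Finsupp.single_apply, hik] using hk'⟩
    · have := ih hL.of_cons (insert i s) (by
        intro k hk
        have : k ≠ i := fun h ↦ (List.nodup_cons.1 hL).1 (h ▸ hk)
        simp [this, hs k (by simp [hk])])
      rwa [Set.image_insert_eq, Set.insert_eq, Ideal.span_union, sup_comm] at this

/-- Forms without a common zero other than the origin, as many as there are variables, form a
regular sequence in any order. -/
theorem isRegularModulo_of_forall_eval_eq_zero [IsAlgClosed K] {m : ℕ}
    {g : Fin m → MvPolynomial (Fin m) K} (hg : ∀ i, IsPosHomogeneous (g i))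
    (hzero : ∀ x : Fin m → K, (∀ i, eval x (g i) = 0) → x = 0) :
    IsRegularModulo ⊥ ((List.finRange m).map g) := by
  have := IsAlgClosed.instInfinite (K := K)
  set l := (List.finRange m).map g with hl
  have hlen : l.length = m := by simp [hl]
  have hrad : idealOfVars (Fin m) K ≤ (Ideal.ofList l).radical := by
    rw [← vanishingIdeal_zeroLocus_eq_radical (K := K), Ideal.span_le]
    rintro _ ⟨i, rfl⟩
    rw [SetLike.mem_coe, mem_vanishingIdeal_iff]
    intro x hx
    have hx0 : x = 0 := hzero x fun i ↦ by
      have := hx (g i) (Ideal.subset_span (by simp [hl]))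
      simpa [aeval_eq_eval] using this
    simp [hx0]
  obtain ⟨D, hD⟩ := Ideal.exists_pow_le_of_le_radical_of_fg hrad (idealOfVars_fg _ _)
  refine isRegularModulo_of_pow_idealOfVars_le (D := D) (b := fun i ↦ X (Fin.cast hlen i))
    (Ideal.IsHomogeneous.bot _) ?_ (by simpa using hD) (fun i ↦ isHomogeneous_X K _) ?_
  · simp only [hl, List.mem_map]
    rintro a ⟨i, -, rfl⟩
    exact hg i
  · have := isRegularModulo_map_X (K := K)
      ((List.nodup_finRange l.length).map (Fin.cast_injective hlen)) ∅ (by simp)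
    simpa [Function.comp_def] using this

end Graded

section Filtered

variable {σ K : Type*} [Field K]

variable (σ K) in
/-- The polynomials of total degree less than `n`. -/
noncomputable def degreeLT (n : ℕ) : Submodule K (MvPolynomial σ K) :=
  restrictSupport K {s | s.degree < n}

theorem mem_degreeLT {n : ℕ} {p : MvPolynomial σ K} :
    p ∈ degreeLT σ K n ↔ ∀ s, n ≤ s.degree → coeff s p = 0 := by
  simp only [degreeLT, mem_restrictSupport_iff, Set.subset_def, Finset.mem_coe, mem_support_iff,
    Set.mem_ofPred_eq]
  exact forall_congr' fun s ↦ by rw [← not_lt]; tauto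

theorem degreeLT_mono {a b : ℕ} (h : a ≤ b) : degreeLT σ K a ≤ degreeLT σ K b :=
  fun _ hp ↦ mem_degreeLT.2 fun s hs ↦ mem_degreeLT.1 hp s (h.trans hs)

@[simp]
theorem degreeLT_zero : degreeLT σ K 0 = ⊥ := by
  rw [eq_bot_iff]
  intro p hp
  exact MvPolynomial.ext _ _ fun s ↦ by simpa using mem_degreeLT.1 hp s (Nat.zero_le _)

theorem degreeLT_succ (n : ℕ) : degreeLT σ K (n + 1) = restrictTotalDegree σ K n := by
  simp only [degreeLT, restrictTotalDegree, Nat.lt_succ_iff]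
  rfl

instance [Finite σ] (n : ℕ) : FiniteDimensional K (degreeLT σ K n) := by
  cases n with
  | zero => rw [degreeLT_zero]; infer_instance
  | succ n => rw [degreeLT_succ]; infer_instance

theorem mul_mem_degreeLT {d e : ℕ} {f p : MvPolynomial σ K} (hf : f ∈ degreeLT σ K (d + 1))
    (hp : p ∈ degreeLT σ K e) : f * p ∈ degreeLT σ K (e + d) := by
  cases e with
  | zero =>
    rw [degreeLT_zero, Submodule.mem_bot] at hp
    simp [hp]
  | succ e =>
    rw [degreeLT_succ, mem_restrictTotalDegree] at hf hp
    rw [show e + 1 + d = (d + e) + 1 by ring, degreeLT_succ, mem_restrictTotalDegree]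
    exact (totalDegree_mul f p).trans (add_le_add hf hp)

theorem homogeneousComponent_mem_degreeLT (n : ℕ) (p : MvPolynomial σ K) :
    homogeneousComponent n p ∈ degreeLT σ K (n + 1) :=
  mem_degreeLT.2 fun s hs ↦ (homogeneousComponent_isHomogeneous n p).coeff_eq_zero (by lia)

theorem homogeneousComponent_eq_zero_of_mem_degreeLT {n : ℕ} {p : MvPolynomial σ K}
    (hp : p ∈ degreeLT σ K n) : homogeneousComponent n p = 0 := by
  ext s
  rw [coeff_homogeneousComponent, coeff_zero]
  split_ifs with h
  exacts [mem_degreeLT.1 hp s h.ge, rfl]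

theorem mem_degreeLT_of_homogeneousComponent_eq_zero {n : ℕ} {p : MvPolynomial σ K}
    (hp : p ∈ degreeLT σ K (n + 1)) (h : homogeneousComponent n p = 0) : p ∈ degreeLT σ K n := by
  refine mem_degreeLT.2 fun s hs ↦ ?_
  rcases hs.eq_or_lt with hs | hs
  · have := congrArg (coeff s) h
    rwa [coeff_homogeneousComponent, if_pos hs.symm, coeff_zero] at this
  · exact mem_degreeLT.1 hp s hs

theorem homogeneousComponent_add_mul {d e : ℕ} {f p : MvPolynomial σ K}
    (hf : f ∈ degreeLT σ K (d + 1)) (hp : p ∈ degreeLT σ K (e + 1)) :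
    homogeneousComponent (d + e) (f * p) = homogeneousComponent d f * homogeneousComponent e p := by
  have hf' : f - homogeneousComponent d f ∈ degreeLT σ K d :=
    mem_degreeLT_of_homogeneousComponent_eq_zero
      (Submodule.sub_mem _ hf (homogeneousComponent_mem_degreeLT d f))
      (by rw [map_sub, homogeneousComponent_eq_self (homogeneousComponent_isHomogeneous d f),
        sub_self])
  have h₁ := homogeneousComponent_mul_of_le (homogeneousComponent_isHomogeneous d f)
    (Nat.le_add_right d e) p
  have h₂ := homogeneousComponent_eq_zero_of_mem_degreeLT (mul_mem_degreeLT hp hf')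
  rw [Nat.add_sub_cancel_left] at h₁
  rw [← h₁, ← sub_eq_zero, ← map_sub, ← h₂]
  ring_nf

variable {ι : Type*} (f : ι → MvPolynomial σ K) (d : ι → ℕ)

/-- The combinations of the `f i`, `i ∈ L`, in which every term has formal degree less than `n`,
`f i` counting as a polynomial of degree `d i`. -/
noncomputable def spanDegreeLT (L : List ι) (n : ℕ) : Submodule K (MvPolynomial σ K) :=
  ⨆ i ∈ L, (degreeLT σ K (n - d i)).map (LinearMap.mulLeft K (f i))

variable {f d}

theorem mul_mem_spanDegreeLT {L : List ι} {i : ι} (hi : i ∈ L) {n : ℕ} {p : MvPolynomial σ K}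
    (hp : p ∈ degreeLT σ K (n - d i)) : f i * p ∈ spanDegreeLT f d L n :=
  Submodule.mem_iSup_of_mem i (Submodule.mem_iSup_of_mem hi ⟨p, hp, rfl⟩)

theorem spanDegreeLT_le_iff {L : List ι} {n : ℕ} {N : Submodule K (MvPolynomial σ K)} :
    spanDegreeLT f d L n ≤ N ↔ ∀ i ∈ L, ∀ p ∈ degreeLT σ K (n - d i), f i * p ∈ N := by
  simp only [spanDegreeLT, iSup_le_iff, Submodule.map_le_iff_le_comap]
  rfl

@[simp]
theorem spanDegreeLT_nil (n : ℕ) : spanDegreeLT f d [] n = ⊥ := by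
  simp [spanDegreeLT]

theorem spanDegreeLT_append_singleton (L : List ι) (i : ι) (n : ℕ) :
    spanDegreeLT f d (L ++ [i]) n =
      spanDegreeLT f d L n ⊔ (degreeLT σ K (n - d i)).map (LinearMap.mulLeft K (f i)) := by
  simp [spanDegreeLT, iSup_or, iSup_sup_eq]

theorem spanDegreeLT_mono {L : List ι} {a b : ℕ} (h : a ≤ b) :
    spanDegreeLT f d L a ≤ spanDegreeLT f d L b :=
  spanDegreeLT_le_iff.2 fun _ hi _ hp ↦
    mul_mem_spanDegreeLT hi (degreeLT_mono (Nat.sub_le_sub_right h _) hp)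

theorem spanDegreeLT_le_degreeLT (hf : ∀ i, f i ∈ degreeLT σ K (d i + 1)) (L : List ι) (n : ℕ) :
    spanDegreeLT f d L n ≤ degreeLT σ K n := by
  refine spanDegreeLT_le_iff.2 fun i _ p hp ↦ ?_
  rcases le_total (d i) n with h | h
  · simpa [h] using mul_mem_degreeLT (hf i) hp
  · rw [Nat.sub_eq_zero_of_le h, degreeLT_zero, Submodule.mem_bot] at hp
    simp [hp]

theorem mul_mem_spanDegreeLT_add {L : List ι} {n e : ℕ} {a p : MvPolynomial σ K}
    (ha : a ∈ degreeLT σ K (e + 1)) (hp : p ∈ spanDegreeLT f d L n) :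
    a * p ∈ spanDegreeLT f d L (n + e) := by
  suffices spanDegreeLT f d L n ≤ (spanDegreeLT f d L (n + e)).comap (LinearMap.mulLeft K a) from
    this hp
  refine spanDegreeLT_le_iff.2 fun i hi q hq ↦ ?_
  rw [Submodule.mem_comap, LinearMap.mulLeft_apply, mul_left_comm]
  refine mul_mem_spanDegreeLT hi ?_
  rcases le_total (d i) n with h | h
  · have := mul_mem_degreeLT ha hq
    rwa [← Nat.sub_add_comm h] at this
  · rw [Nat.sub_eq_zero_of_le h, degreeLT_zero, Submodule.mem_bot] at hq
    simp [hq]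

theorem homogeneousComponent_mem_ofList (hf : ∀ i, f i ∈ degreeLT σ K (d i + 1)) {L : List ι}
    {n : ℕ} {q : MvPolynomial σ K} (hq : q ∈ spanDegreeLT f d L (n + 1)) :
    homogeneousComponent n q ∈
      Ideal.ofList (L.map fun i ↦ homogeneousComponent (d i) (f i)) := by
  suffices spanDegreeLT f d L (n + 1) ≤ ((Ideal.ofList (L.map fun i ↦
      homogeneousComponent (d i) (f i))).restrictScalars K).comap (homogeneousComponent n) from
    this hq
  refine spanDegreeLT_le_iff.2 fun i hi p hp ↦ ?_
  rw [Submodule.mem_comap, Submodule.restrictScalars_mem]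
  rcases lt_or_ge n (d i) with h | h
  · rw [Nat.sub_eq_zero_of_le h, degreeLT_zero, Submodule.mem_bot] at hp
    simp [hp]
  · obtain ⟨e, rfl⟩ := Nat.exists_eq_add_of_le h
    rw [add_assoc, Nat.add_sub_cancel_left] at hp
    rw [homogeneousComponent_add_mul (hf i) hp]
    exact Ideal.mul_mem_right _ _ (Ideal.subset_span (List.mem_map.2 ⟨i, hi, rfl⟩))

theorem exists_homogeneousComponent_eq (hf : ∀ i, f i ∈ degreeLT σ K (d i + 1)) {L : List ι}
    (e : ℕ) {p : MvPolynomial σ K}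
    (hp : p ∈ Ideal.ofList (L.map fun i ↦ homogeneousComponent (d i) (f i))) :
    ∃ r ∈ spanDegreeLT f d L (e + 1), homogeneousComponent e r = homogeneousComponent e p := by
  suffices ∀ a, ∃ r ∈ spanDegreeLT f d L (e + 1),
      homogeneousComponent e r = homogeneousComponent e (a * p) by simpa using this 1
  refine Submodule.span_induction (p := fun p _ ↦ ∀ a, ∃ r ∈ spanDegreeLT f d L (e + 1),
      homogeneousComponent e r = homogeneousComponent e (a * p)) ?_ ?_ ?_ ?_ hp
  · intro g hg a
    obtain ⟨i, hi, rfl⟩ := List.mem_map.1 hg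
    rw [mul_comm]
    rcases lt_or_ge e (d i) with h | h
    · exact ⟨0, Submodule.zero_mem _, by
        rw [homogeneousComponent_mul_of_lt (homogeneousComponent_isHomogeneous _ _) h, map_zero]⟩
    · obtain ⟨k, rfl⟩ := Nat.exists_eq_add_of_le h
      have hk := homogeneousComponent_mem_degreeLT k a
      refine ⟨f i * homogeneousComponent k a, mul_mem_spanDegreeLT hi ?_, ?_⟩
      · rwa [add_assoc, Nat.add_sub_cancel_left]
      · rw [homogeneousComponent_add_mul (hf i) hk,
          homogeneousComponent_mul_of_le (homogeneousComponent_isHomogeneous _ _) h,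
          homogeneousComponent_eq_self (homogeneousComponent_isHomogeneous _ _),
          Nat.add_sub_cancel_left]
  · exact fun a ↦ ⟨0, Submodule.zero_mem _, by simp⟩
  · intro x y _ _ hx hy a
    obtain ⟨r, hr, hr'⟩ := hx a
    obtain ⟨s, hs, hs'⟩ := hy a
    exact ⟨r + s, Submodule.add_mem _ hr hs, by rw [mul_add, map_add, map_add, hr', hs']⟩
  · intro b x _ hx a
    obtain ⟨r, hr, hr'⟩ := hx (a * b)
    exact ⟨r, hr, by rw [hr', smul_eq_mul, mul_assoc]⟩

/-- If `p` of degree at most `e` has its top component in the ideal of top components, it can be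
reduced to smaller degree. -/
theorem exists_sub_mem_degreeLT (hf : ∀ i, f i ∈ degreeLT σ K (d i + 1)) {L : List ι} {e : ℕ}
    {p : MvPolynomial σ K} (hp : p ∈ degreeLT σ K (e + 1))
    (h : homogeneousComponent e p ∈
      Ideal.ofList (L.map fun i ↦ homogeneousComponent (d i) (f i))) :
    ∃ r ∈ spanDegreeLT f d L (e + 1), p - r ∈ degreeLT σ K e := by
  obtain ⟨r, hr, hre⟩ := exists_homogeneousComponent_eq hf e h
  rw [homogeneousComponent_eq_self (homogeneousComponent_isHomogeneous e p)] at hre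
  refine ⟨r, hr, mem_degreeLT_of_homogeneousComponent_eq_zero
    (Submodule.sub_mem _ hp (spanDegreeLT_le_degreeLT hf _ _ hr)) ?_⟩
  rw [map_sub, hre, sub_self]

/-- If the top components form a regular sequence, cancellation of top degrees in a combination
of the `f i` can be removed from the combination itself. -/
theorem mem_spanDegreeLT_of_mem_degreeLT (hf : ∀ i, f i ∈ degreeLT σ K (d i + 1)) {L : List ι}
    (hL : IsRegularModulo ⊥ (L.map fun i ↦ homogeneousComponent (d i) (f i))) {n : ℕ}
    {q : MvPolynomial σ K} (hq : q ∈ spanDegreeLT f d L (n + 1)) (hqn : q ∈ degreeLT σ K n) :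
    q ∈ spanDegreeLT f d L n := by
  induction L using List.reverseRecOn generalizing q with
  | nil => simpa using hq
  | append_singleton L i ih =>
    rw [List.map_append, isRegularModulo_append, bot_sup_eq] at hL
    obtain ⟨hL, hi, -⟩ := hL
    rw [spanDegreeLT_append_singleton] at hq ⊢
    obtain ⟨q₁, hq₁, _, ⟨p, hp, rfl⟩, rfl⟩ := Submodule.mem_sup.1 hq
    rw [LinearMap.mulLeft_apply] at *
    rcases lt_or_ge n (d i) with h | h
    · rw [Nat.sub_eq_zero_of_le h, degreeLT_zero, SetLike.mem_coe, Submodule.mem_bot] at hp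
      subst hp
      rw [mul_zero, add_zero] at *
      exact Submodule.mem_sup_left (ih hL hq₁ hqn)
    · obtain ⟨e, rfl⟩ := Nat.exists_eq_add_of_le h
      rw [add_assoc, Nat.add_sub_cancel_left] at hp
      have h₀ := homogeneousComponent_eq_zero_of_mem_degreeLT hqn
      rw [map_add, homogeneousComponent_add_mul (hf i) hp] at h₀
      have h₁ := hi _ (by
        rw [eq_neg_of_add_eq_zero_right h₀]
        exact Ideal.neg_mem_iff _ |>.2 (homogeneousComponent_mem_ofList hf hq₁))
      obtain ⟨r, hr, hpr⟩ := exists_sub_mem_degreeLT hf hp h₁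
      have h₂ : q₁ + f i * r ∈ spanDegreeLT f d L (d i + e) := by
        refine ih hL (Submodule.add_mem _ hq₁ ?_) ?_
        · have := mul_mem_spanDegreeLT_add (hf i) hr
          rwa [show e + 1 + d i = d i + e + 1 by ring] at this
        · have := Submodule.sub_mem _ hqn
            (by simpa [add_comm] using mul_mem_degreeLT (hf i) hpr : _ ∈ degreeLT σ K (d i + e))
          convert this using 1
          ring
      have h₃ : q₁ + f i * p = q₁ + f i * r + f i * (p - r) := by ring
      rw [h₃]
      refine Submodule.add_mem_sup h₂ ⟨p - r, ?_, rfl⟩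
      rwa [Nat.add_sub_cancel_left]

theorem mem_spanDegreeLT_of_mul_mem (hf : ∀ i, f i ∈ degreeLT σ K (d i + 1)) {L : List ι} {i : ι}
    (hL : IsRegularModulo ⊥ ((L ++ [i]).map fun i ↦ homogeneousComponent (d i) (f i))) {e : ℕ}
    {p : MvPolynomial σ K} (hp : p ∈ degreeLT σ K e)
    (hfp : f i * p ∈ spanDegreeLT f d L (e + d i)) : p ∈ spanDegreeLT f d L e := by
  rw [List.map_append, isRegularModulo_append, bot_sup_eq] at hL
  obtain ⟨hL, hi, -⟩ := hL
  induction e generalizing p with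
  | zero =>
    rw [degreeLT_zero, Submodule.mem_bot] at hp
    simp [hp]
  | succ e ih =>
    rw [show e + 1 + d i = d i + e + 1 by ring] at hfp
    have h₀ := homogeneousComponent_mem_ofList hf hfp
    rw [homogeneousComponent_add_mul (hf i) hp] at h₀
    obtain ⟨r, hr, hpr⟩ := exists_sub_mem_degreeLT hf hp (hi _ h₀)
    have h₁ : f i * (p - r) ∈ spanDegreeLT f d L (e + d i) := by
      refine mem_spanDegreeLT_of_mem_degreeLT hf hL ?_ (mul_mem_degreeLT (hf i) hpr)
      rw [mul_sub]
      have := mul_mem_spanDegreeLT_add (hf i) hr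
      rw [show e + 1 + d i = d i + e + 1 by ring] at this
      rw [add_comm e]
      exact Submodule.sub_mem _ hfp this
    have := Submodule.add_mem _ (spanDegreeLT_mono (Nat.le_succ e) (ih hpr h₁)) hr
    rwa [sub_add_cancel] at this

theorem spanDegreeLT_inf_map_mulLeft (hf : ∀ i, f i ∈ degreeLT σ K (d i + 1)) {L : List ι} {i : ι}
    (hL : IsRegularModulo ⊥ ((L ++ [i]).map fun i ↦ homogeneousComponent (d i) (f i))) (n : ℕ) :
    spanDegreeLT f d L n ⊓ (degreeLT σ K (n - d i)).map (LinearMap.mulLeft K (f i)) =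
      (spanDegreeLT f d L (n - d i)).map (LinearMap.mulLeft K (f i)) := by
  rcases le_total n (d i) with h | h
  · have h₀ := spanDegreeLT_le_degreeLT hf L 0
    rw [degreeLT_zero, le_bot_iff] at h₀
    simp [Nat.sub_eq_zero_of_le h, h₀]
  · obtain ⟨e, rfl⟩ := Nat.exists_eq_add_of_le' h
    rw [Nat.add_sub_cancel]
    apply le_antisymm
    · rintro _ ⟨h₁, p, hp, rfl⟩
      exact ⟨p, mem_spanDegreeLT_of_mul_mem hf hL hp h₁, rfl⟩
    · rintro _ ⟨p, hp, rfl⟩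
      exact ⟨mul_mem_spanDegreeLT_add (hf i) hp, p, spanDegreeLT_le_degreeLT hf _ _ hp, rfl⟩

theorem finrank_spanDegreeLT_append_singleton [Finite σ]
    (hf : ∀ i, f i ∈ degreeLT σ K (d i + 1)) {L : List ι} {i : ι} (hi : f i ≠ 0)
    (hL : IsRegularModulo ⊥ ((L ++ [i]).map fun i ↦ homogeneousComponent (d i) (f i))) (n : ℕ) :
    Module.finrank K (spanDegreeLT f d (L ++ [i]) n) +
        Module.finrank K (spanDegreeLT f d L (n - d i)) =
      Module.finrank K (spanDegreeLT f d L n) + Module.finrank K (degreeLT σ K (n - d i)) := by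
  have hinj : Function.Injective (LinearMap.mulLeft K (f i)) := mul_right_injective₀ hi
  have : FiniteDimensional K (spanDegreeLT f d L n) :=
    Submodule.finiteDimensional_of_le (spanDegreeLT_le_degreeLT hf L n)
  have hmap : ∀ N : Submodule K (MvPolynomial σ K),
      Module.finrank K (N.map (LinearMap.mulLeft K (f i))) = Module.finrank K N :=
    fun N ↦ (Submodule.equivMapOfInjective _ hinj N).finrank_eq.symm
  rw [← hmap (spanDegreeLT f d L (n - d i)), ← spanDegreeLT_inf_map_mulLeft hf hL,
    spanDegreeLT_append_singleton, ← hmap (degreeLT σ K (n - d i))]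
  exact Submodule.finrank_sup_add_finrank_inf_eq _ _

variable (f d) in
/-- The generating function of the codimension of `spanDegreeLT f d L n` in `degreeLT σ K n`. -/
noncomputable def codimSeries (L : List ι) : PowerSeries ℤ :=
  PowerSeries.mk fun n ↦ (Module.finrank K (degreeLT σ K n) : ℤ) -
    Module.finrank K (spanDegreeLT f d L n)

theorem codimSeries_eq_prod_mul [Finite σ] (hf : ∀ i, f i ∈ degreeLT σ K (d i + 1))
    (hf0 : ∀ i, f i ≠ 0) {L : List ι}
    (hL : IsRegularModulo ⊥ (L.map fun i ↦ homogeneousComponent (d i) (f i))) :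
    codimSeries f d L =
      (L.map fun i ↦ 1 - PowerSeries.X ^ d i).prod * codimSeries f d [] := by
  induction L using List.reverseRecOn with
  | nil => simp
  | append_singleton L i ih =>
    have hL' := hL
    rw [List.map_append, isRegularModulo_append] at hL'
    rw [List.map_append, List.prod_append, List.map_singleton, List.prod_singleton, mul_right_comm,
      ← ih hL'.1]
    ext n
    have h := finrank_spanDegreeLT_append_singleton hf (hf0 i) hL n
    rw [mul_sub, mul_one, map_sub, mul_comm, PowerSeries.coeff_X_pow_mul']
    simp only [codimSeries, PowerSeries.coeff_mk]
    split_ifs with hn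
    · lia
    · have h₀ := spanDegreeLT_le_degreeLT hf L 0
      rw [degreeLT_zero, le_bot_iff] at h₀
      rw [Nat.sub_eq_zero_of_le (by lia), h₀, degreeLT_zero, finrank_bot] at h
      lia

end Filtered

section Count

variable {σ K : Type*} [Field K]

theorem X_mem_degreeLT (i : σ) : (X i : MvPolynomial σ K) ∈ degreeLT σ K (1 + 1) := by
  rw [degreeLT_succ, mem_restrictTotalDegree, totalDegree_X]

theorem spanDegreeLT_X {L : List σ} (hL : ∀ i, i ∈ L) (n : ℕ) :
    spanDegreeLT (X : σ → MvPolynomial σ K) 1 L n = degreeLT σ K n ⊓ (lcoeff K 0).ker := by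
  apply le_antisymm
  · refine le_inf (spanDegreeLT_le_degreeLT X_mem_degreeLT L n) (spanDegreeLT_le_iff.2 ?_)
    intro i _ p _
    rw [LinearMap.mem_ker, lcoeff_apply, ← constantCoeff_eq, map_mul, constantCoeff_X, zero_mul]
  · classical
    rintro p ⟨hp, hp₀⟩
    rw [p.as_sum]
    refine Submodule.sum_mem _ fun s hs ↦ ?_
    have hsn : s.degree < n := by
      by_contra! h
      exact mem_support_iff.1 hs (mem_degreeLT.1 hp s h)
    have hs0 : s ≠ 0 := by
      rintro rfl
      exact mem_support_iff.1 hs hp₀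
    obtain ⟨i, hi⟩ := Finsupp.ne_iff.1 hs0
    have hsi : Finsupp.single i 1 ≤ s := by
      rw [Finsupp.single_le_iff]
      exact Nat.one_le_iff_ne_zero.2 hi
    obtain ⟨t, rfl⟩ := exists_add_of_le hsi
    have ht : monomial (Finsupp.single i 1 + t) (coeff (Finsupp.single i 1 + t) p) =
        X i * monomial t (coeff (Finsupp.single i 1 + t) p) := by
      rw [X, monomial_mul, one_mul]
    rw [ht]
    refine mul_mem_spanDegreeLT (hL i) (mem_degreeLT.2 fun u hu ↦ ?_)
    rw [coeff_monomial, if_neg]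
    rintro rfl
    rw [map_add, Finsupp.degree_single] at hsn
    rw [Pi.one_apply] at hu
    lia

theorem finrank_degreeLT_inf_ker_lcoeff_zero [Finite σ] (n : ℕ) :
    Module.finrank K (degreeLT σ K (n + 1) ⊓ (lcoeff K 0).ker : Submodule K (MvPolynomial σ K)) + 1
      = Module.finrank K (degreeLT σ K (n + 1)) := by
  have h := ((lcoeff K (0 : σ →₀ ℕ)).domRestrict
    (degreeLT σ K (n + 1))).finrank_range_add_finrank_ker
  have hsurj : Function.Surjective ((lcoeff K (0 : σ →₀ ℕ)).domRestrict
      (degreeLT σ K (n + 1))) := fun a ↦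
    ⟨⟨C a, by rw [degreeLT_succ, mem_restrictTotalDegree, totalDegree_C]; exact Nat.zero_le _⟩,
      by simp⟩
  rw [LinearMap.range_eq_top.2 hsurj, finrank_top, Module.finrank_self,
    LinearMap.ker_domRestrict] at h
  rw [← h, add_comm, inf_comm, ← Submodule.finrank_map_subtype_eq,
    Submodule.map_comap_subtype, inf_comm]

theorem codimSeries_X [Finite σ] {L : List σ} (hL : ∀ i, i ∈ L) :
    codimSeries (X : σ → MvPolynomial σ K) 1 L = PowerSeries.X * PowerSeries.mk 1 := by
  ext n
  rw [codimSeries, PowerSeries.coeff_mk, spanDegreeLT_X hL]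
  cases n with
  | zero =>
    rw [degreeLT_zero, bot_inf_eq]
    simp
  | succ n =>
    rw [PowerSeries.coeff_succ_X_mul, ← finrank_degreeLT_inf_ker_lcoeff_zero]
    simp

theorem codimSeries_nil {ι : Type*} (f : ι → MvPolynomial σ K) (d : ι → ℕ) :
    codimSeries f d [] = PowerSeries.mk fun n ↦ (Module.finrank K (degreeLT σ K n) : ℤ) := by
  ext n
  rw [codimSeries, PowerSeries.coeff_mk, PowerSeries.coeff_mk, spanDegreeLT_nil, finrank_bot,
    Nat.cast_zero, sub_zero]

theorem prod_mul_codimSeries_nil {ι : Type*} {m : ℕ} (f : ι → MvPolynomial (Fin m) K) (d : ι → ℕ) :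
    (1 - PowerSeries.X) ^ m * codimSeries f d [] = PowerSeries.X * PowerSeries.mk 1 := by
  have hL : IsRegularModulo (⊥ : Ideal (MvPolynomial (Fin m) K)) ((List.finRange m).map fun i ↦
      homogeneousComponent ((1 : Fin m → ℕ) i) (X i)) := by
    simpa [homogeneousComponent_eq_self (isHomogeneous_X K _)] using
      isRegularModulo_map_X (K := K) (List.nodup_finRange m) ∅ (by simp)
  have h := codimSeries_eq_prod_mul (d := 1) X_mem_degreeLT (fun i ↦ X_ne_zero i) hL
  rw [codimSeries_X List.mem_finRange] at h
  rw [h, codimSeries_nil f d, codimSeries_nil X 1]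
  simp

theorem coeff_mul_mk_one {Q : Polynomial ℤ} {n : ℕ} (hQ : Q.natDegree ≤ n) :
    PowerSeries.coeff n ((Q : PowerSeries ℤ) * PowerSeries.mk 1) = Q.eval 1 := by
  rw [PowerSeries.coeff_mul, Finset.Nat.sum_antidiagonal_eq_sum_range_succ_mk,
    Polynomial.eval_eq_sum_range' (Nat.lt_succ_of_le hQ)]
  simp

variable {m : ℕ} {f : Fin m → MvPolynomial (Fin m) K} {d : Fin m → ℕ}

theorem finrank_spanDegreeLT_add_prod (hf : ∀ i, f i ∈ degreeLT (Fin m) K (d i + 1))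
    (hf0 : ∀ i, f i ≠ 0)
    (hL : IsRegularModulo ⊥ ((List.finRange m).map fun i ↦ homogeneousComponent (d i) (f i)))
    {n : ℕ} (hn : ∑ i, (d i - 1) ≤ n) :
    Module.finrank K (spanDegreeLT f d (List.finRange m) (n + 1)) + ∏ i, d i =
      Module.finrank K (degreeLT (Fin m) K (n + 1)) := by
  set Q : Polynomial ℤ := ∏ i, ∑ k ∈ Finset.range (d i), Polynomial.X ^ k with hQ
  have hdeg : Q.natDegree ≤ n := by
    refine (Polynomial.natDegree_prod_le _ _).trans (le_trans (Finset.sum_le_sum fun i _ ↦ ?_) hn)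
    refine Polynomial.natDegree_sum_le_of_forall_le _ _ fun k hk ↦ ?_
    rw [Polynomial.natDegree_X_pow]
    rw [Finset.mem_range] at hk
    lia
  have hQ₁ : Q.eval 1 = ∏ i, (d i : ℤ) := by
    simp [hQ, Polynomial.eval_prod, Polynomial.eval_finsetSum]
  have hprod : ((List.finRange m).map fun i ↦ (1 - PowerSeries.X ^ d i : PowerSeries ℤ)).prod =
      (1 - PowerSeries.X) ^ m * (Q : PowerSeries ℤ) := by
    rw [← List.ofFn_eq_map, List.prod_ofFn, ← Fin.prod_const, hQ,
      ← Polynomial.coeToPowerSeries.ringHom_apply, map_prod, ← Finset.prod_mul_distrib]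
    refine Finset.prod_congr rfl fun i _ ↦ ?_
    rw [← mul_neg_geom_sum]
    simp
  have h := codimSeries_eq_prod_mul hf hf0 hL
  rw [hprod, mul_right_comm, prod_mul_codimSeries_nil, mul_assoc, mul_comm (PowerSeries.mk 1)] at h
  have h₁ := congrArg (PowerSeries.coeff (n + 1)) h
  rw [PowerSeries.coeff_succ_X_mul, coeff_mul_mk_one hdeg, hQ₁, codimSeries,
    PowerSeries.coeff_mk] at h₁
  zify
  lia

theorem mem_spanDegreeLT_of_mem_span (hf : ∀ i, f i ∈ degreeLT (Fin m) K (d i + 1))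
    (hL : IsRegularModulo ⊥ ((List.finRange m).map fun i ↦ homogeneousComponent (d i) (f i)))
    {n : ℕ} {q : MvPolynomial (Fin m) K} (hq : q ∈ Ideal.span (Set.range f))
    (hqn : q ∈ degreeLT (Fin m) K n) : q ∈ spanDegreeLT f d (List.finRange m) n := by
  have hN : ∃ N, q ∈ spanDegreeLT f d (List.finRange m) (n + N) := by
    obtain ⟨c, rfl⟩ := (Ideal.mem_span_range_iff_exists_fun).1 hq
    refine ⟨∑ i, (d i + (c i).totalDegree + 1), Submodule.sum_mem _ fun i _ ↦ ?_⟩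
    rw [mul_comm]
    refine mul_mem_spanDegreeLT (List.mem_finRange i)
      (degreeLT_mono (a := (c i).totalDegree + 1) ?_ ?_)
    · have := Finset.single_le_sum (f := fun i ↦ d i + (c i).totalDegree + 1)
        (fun _ _ ↦ Nat.zero_le _) (Finset.mem_univ i)
      lia
    · rw [degreeLT_succ, mem_restrictTotalDegree]
  obtain ⟨N, hN⟩ := hN
  induction N with
  | zero => exact hN
  | succ N ih =>
    exact ih (mem_spanDegreeLT_of_mem_degreeLT hf hL hN (degreeLT_mono (Nat.le_add_right n N) hqn))

theorem spanDegreeLT_eq_inf (hf : ∀ i, f i ∈ degreeLT (Fin m) K (d i + 1))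
    (hL : IsRegularModulo ⊥ ((List.finRange m).map fun i ↦ homogeneousComponent (d i) (f i)))
    (n : ℕ) :
    spanDegreeLT f d (List.finRange m) n =
      degreeLT (Fin m) K n ⊓ (Ideal.span (Set.range f)).restrictScalars K := by
  refine le_antisymm (le_inf (spanDegreeLT_le_degreeLT hf _ _) (spanDegreeLT_le_iff.2 ?_))
    fun q hq ↦ mem_spanDegreeLT_of_mem_span hf hL hq.2 hq.1
  exact fun i _ p _ ↦ Ideal.mul_mem_right _ _ (Ideal.subset_span ⟨i, rfl⟩)

/-- If the codimension of `I` in the polynomials of degree less than `n` is eventually constant,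
it is the dimension of the quotient by `I`. -/
theorem finrank_quotient_of_finrank_inf [Finite σ] (I : Ideal (MvPolynomial σ K)) {N c : ℕ}
    (h : ∀ n, N ≤ n → Module.finrank K (degreeLT σ K n ⊓ I.restrictScalars K :
      Submodule K (MvPolynomial σ K)) + c = Module.finrank K (degreeLT σ K n)) :
    FiniteDimensional K (MvPolynomial σ K ⧸ I) ∧ Module.finrank K (MvPolynomial σ K ⧸ I) = c := by
  set π : MvPolynomial σ K →ₗ[K] MvPolynomial σ K ⧸ I := (Ideal.Quotient.mkₐ K I).toLinearMap
  have hker : π.ker = I.restrictScalars K := by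
    ext p
    exact Ideal.Quotient.eq_zero_iff_mem
  have hV : ∀ n, N ≤ n → Module.finrank K ((degreeLT σ K n).map π) = c := by
    intro n hn
    have h₁ := (π.domRestrict (degreeLT σ K n)).finrank_range_add_finrank_ker
    rw [LinearMap.range_domRestrict, LinearMap.ker_domRestrict, hker,
      ← Submodule.finrank_map_subtype_eq, Submodule.map_comap_subtype, ← h n hn] at h₁
    lia
  have htop : (degreeLT σ K N).map π = ⊤ := by
    rw [eq_top_iff]
    intro x _
    obtain ⟨p, rfl⟩ := Ideal.Quotient.mk_surjective x
    have hNn : N ≤ max N (p.totalDegree + 1) := le_max_left _ _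
    rw [Submodule.eq_of_le_of_finrank_eq (Submodule.map_mono (degreeLT_mono hNn))
      ((hV N le_rfl).trans (hV _ hNn).symm)]
    refine ⟨p, degreeLT_mono (le_max_right _ _) ?_, rfl⟩
    rw [degreeLT_succ, mem_restrictTotalDegree]
  refine ⟨Module.finite_def.2 ?_, by rw [← hV N le_rfl, htop, finrank_top]⟩
  rw [← htop]
  exact Module.Finite.iff_fg.1 inferInstance

theorem span_eq_spanDegreeLT (n : ℕ) :
    Submodule.span K {q | ∃ (i : Fin m) (p : MvPolynomial (Fin m) K),
      p.totalDegree + d i ≤ n ∧ q = f i * p} = spanDegreeLT f d (List.finRange m) (n + 1) := by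
  apply le_antisymm
  · rw [Submodule.span_le]
    rintro _ ⟨i, p, hp, rfl⟩
    refine mul_mem_spanDegreeLT (List.mem_finRange i) ?_
    rw [Nat.sub_add_comm (by lia), degreeLT_succ, mem_restrictTotalDegree]
    lia
  · refine spanDegreeLT_le_iff.2 fun i _ p hp ↦ ?_
    rcases lt_or_ge n (d i) with h | h
    · rw [Nat.sub_eq_zero_of_le h, degreeLT_zero, Submodule.mem_bot] at hp
      simp [hp]
    · rw [Nat.sub_add_comm h, degreeLT_succ, mem_restrictTotalDegree] at hp
      exact Submodule.subset_span ⟨i, p, by lia, rfl⟩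

end Count

/-- Let `K` be an algebraically closed field and
`f₁, …, f_m ∈ K[x₁, …, x_m]` with total degrees `d₁, …, d_m ≥ 1`, whose leading
forms have no common zero in `Kᵐ` other than the origin.  Set
`δ = ∑ i (dᵢ - 1)`.  Then for every `d ≥ δ`, the `K`-dimension of the quotient
`K[x]_{≤ d} / ⟨f⟩_d` equals `∏ i, dᵢ`, which also equals
`dim_K K[x₁, …, x_m]/⟨f₁, …, f_m⟩`.  Here `⟨f⟩_d` is the span of the products
`fᵢ · p` with `deg p ≤ d - dᵢ`, and `K[x]_{≤ d}` the space of polynomials of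
total degree at most `d`. -/
theorem stmt2 {K : Type*} [Field K] [IsAlgClosed K] (m : ℕ)
    (f : Fin m → MvPolynomial (Fin m) K) (dd : Fin m → ℕ)
    (hd : ∀ i, 1 ≤ dd i)
    (hdeg : ∀ i, (f i).totalDegree = dd i)
    (hlead : ∀ x : Fin m → K,
      (∀ i, eval x (homogeneousComponent (dd i) (f i)) = 0) → x = 0)
    (δ : ℕ) (hδ : δ = ∑ i, (dd i - 1)) :
    (∀ d, δ ≤ d →
      Module.finrank K
        (↥(restrictTotalDegree (Fin m) K d) ⧸
          (Submodule.span K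
            {q | ∃ (i : Fin m) (p : MvPolynomial (Fin m) K),
              p.totalDegree + dd i ≤ d ∧ q = f i * p}).comap
            (restrictTotalDegree (Fin m) K d).subtype)
        = ∏ i, dd i) ∧
    FiniteDimensional K (MvPolynomial (Fin m) K ⧸ Ideal.span (Set.range f)) ∧
    Module.finrank K (MvPolynomial (Fin m) K ⧸ Ideal.span (Set.range f))
      = ∏ i, dd i := by
  subst hδ
  have hf : ∀ i, f i ∈ degreeLT (Fin m) K (dd i + 1) := fun i ↦ by
    rw [degreeLT_succ, mem_restrictTotalDegree, hdeg]
  have hf0 : ∀ i, f i ≠ 0 := fun i h ↦ by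
    have := hd i
    simp [← hdeg i, h] at this
  have hL := isRegularModulo_of_forall_eval_eq_zero
    (fun i ↦ ⟨dd i, hd i, homogeneousComponent_isHomogeneous (dd i) (f i)⟩) hlead
  refine ⟨fun d h ↦ ?_, finrank_quotient_of_finrank_inf _ (N := ∑ i, (dd i - 1) + 1) fun n hn ↦ ?_⟩
  · have h₁ := finrank_spanDegreeLT_add_prod hf hf0 hL h
    have h₂ := spanDegreeLT_le_degreeLT hf (List.finRange m) (d + 1)
    rw [degreeLT_succ] at h₁ h₂
    rw [span_eq_spanDegreeLT]
    have h₃ := Submodule.finrank_quotient_add_finrank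
      ((spanDegreeLT f dd (List.finRange m) (d + 1)).comap
        (restrictTotalDegree (Fin m) K d).subtype)
    rw [(Submodule.comapSubtypeEquivOfLe h₂).finrank_eq] at h₃
    lia
  · obtain ⟨n, rfl⟩ := Nat.exists_eq_add_of_le' (Nat.one_le_of_lt hn)
    rw [← spanDegreeLT_eq_inf hf hL]
    exact finrank_spanDegreeLT_add_prod hf hf0 hL (by lia)
end

section
/- Let K be an algebraically closed field and let f_1,…,f_s ∈ K[x_1,…,x_m] with s > m, having total degrees d_1 ≥ d_2 ≥ … ≥ d_s ≥ 1. Assume the leading forms of f_1,…,f_s have no common zero in K^m other than the origin (so the system has finitely many projective common roots and none at infinity). Set δ = (Σ_{i=1}^{m+1} d_i) − m. Then for every d ≥ δ, the K-dimension of K[x]_{≤d}/⟨f⟩_d is the same, and this common value equals dim_K K[x_1,…,x_m]/⟨f_1,…,f_s⟩, which is finite. -/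
open MvPolynomial

section InitialIdeals

variable {R : Type*} [CommRing R]

/-- The ideal generated by the first `r` terms of a sequence. -/
def initialSpan (g : ℕ → R) (r : ℕ) : Ideal R := Ideal.span (g '' Set.Iio r)

/-- The first `n` terms of `g` form a weakly regular sequence. -/
def IsRegularUpTo (g : ℕ → R) (n : ℕ) : Prop :=
  ∀ r < n, ∀ u, g r * u ∈ initialSpan g r → u ∈ initialSpan g r

@[simp] lemma initialSpan_zero (g : ℕ → R) : initialSpan g 0 = ⊥ := by
  simp [initialSpan]

lemma initialSpan_succ (g : ℕ → R) (r : ℕ) :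
    initialSpan g (r + 1) = Ideal.span {g r} ⊔ initialSpan g r := by
  rw [initialSpan, ← Order.succ_eq_add_one, Order.Iio_succ_eq_insert, Set.image_insert_eq,
    Ideal.span_insert, initialSpan]

lemma initialSpan_congr {g g' : ℕ → R} {r : ℕ} (h : ∀ i < r, g i = g' i) :
    initialSpan g r = initialSpan g' r := by
  rw [initialSpan, initialSpan, Set.image_congr (s := Set.Iio r) h]

lemma mem_initialSpan {g : ℕ → R} {i r : ℕ} (hi : i < r) : g i ∈ initialSpan g r :=
  Ideal.subset_span ⟨i, hi, rfl⟩

lemma mem_initialSpan_succ {g : ℕ → R} {r : ℕ} {q : R} :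
    q ∈ initialSpan g (r + 1) ↔ ∃ b, q - g r * b ∈ initialSpan g r := by
  rw [initialSpan_succ, Ideal.mem_span_singleton_sup]
  constructor
  · rintro ⟨a, b, hb, rfl⟩
    exact ⟨a, by convert hb using 1; ring⟩
  · rintro ⟨b, hb⟩
    exact ⟨b, _, hb, by ring⟩

lemma IsRegularUpTo.congr {g g' : ℕ → R} {n : ℕ} (hg : IsRegularUpTo g n)
    (h : ∀ i < n, g i = g' i) : IsRegularUpTo g' n := by
  intro r hr u hu
  rw [← initialSpan_congr fun i hi => h i (hi.trans hr)] at hu ⊢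
  exact hg r hr u (by rwa [h r hr])

lemma IsRegularUpTo.mono {g : ℕ → R} {n k : ℕ} (hg : IsRegularUpTo g n) (hk : k ≤ n) :
    IsRegularUpTo g k := fun r hr => hg r (hr.trans_le hk)

end InitialIdeals

section Depth

universe u
open CategoryTheory Abelian

variable {R : Type u} [CommRing R]

lemma exact_mul_factor {I I' : Ideal R} {a : R} (h : I' = Ideal.span {a} ⊔ I) :
    Function.Exact (LinearMap.lsmul R (R ⧸ I) a)
      (Submodule.factor (h ▸ le_sup_right : I ≤ I')) := by
  subst h
  intro y
  obtain ⟨y, rfl⟩ := Submodule.Quotient.mk_surjective _ y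
  rw [← Submodule.mkQ_apply, Submodule.factor_mk, Submodule.mkQ_apply,
    Submodule.Quotient.mk_eq_zero, Ideal.mem_span_singleton_sup]
  constructor
  · rintro ⟨b, c, hc, rfl⟩
    refine ⟨Submodule.Quotient.mk b, ?_⟩
    rw [LinearMap.lsmul_apply, ← Submodule.Quotient.mk_smul, Submodule.mkQ_apply,
      Submodule.Quotient.eq]
    convert I.neg_mem hc using 1
    rw [smul_eq_mul]
    ring
  · rintro ⟨b, hb⟩
    obtain ⟨b, rfl⟩ := Submodule.Quotient.mk_surjective _ b
    rw [LinearMap.lsmul_apply, ← Submodule.Quotient.mk_smul, Submodule.mkQ_apply,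
      Submodule.Quotient.eq] at hb
    refine ⟨b, _, I.neg_mem hb, ?_⟩
    rw [smul_eq_mul]
    ring

lemma shortExact_mul_factor {I I' : Ideal R} {a : R} (h : I' = Ideal.span {a} ⊔ I)
    (ha : ∀ u, a * u ∈ I → u ∈ I) :
    (ModuleCat.shortComplexOfCompEqZero _ _
      (exact_mul_factor h).linearMap_comp_eq_zero).ShortExact where
  exact := ModuleCat.shortComplex_exact _ (exact_mul_factor h)
  mono_f := (ModuleCat.mono_iff_injective _).mpr
    ((isSMulRegular_quotient_iff_mem_of_smul_mem I a).mpr ha)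
  epi_g := (ModuleCat.epi_iff_surjective _).mpr (Submodule.factor_surjective (h ▸ le_sup_right))

lemma subsingleton_ext_quotient (N : ModuleCat.{u} R) {n : ℕ}
    (hN : ∀ i < n, Subsingleton (Ext N (ModuleCat.of R R) i)) {g : ℕ → R} {r : ℕ}
    (hg : IsRegularUpTo g r) :
    ∀ i, i + r < n → Subsingleton (Ext N (ModuleCat.of R (R ⧸ initialSpan g r)) i) := by
  induction r with
  | zero =>
    intro i hi
    have e : ModuleCat.of R (R ⧸ initialSpan g 0) ≅ ModuleCat.of R R :=
      (Submodule.quotEquivOfEqBot _ (initialSpan_zero g)).toModuleIso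
    have : Subsingleton ((extFunctorObj N i).obj (ModuleCat.of R R)) := hN i hi
    exact ((extFunctorObj N i).mapIso e).addCommGroupIsoToAddEquiv.subsingleton
  | succ r ih =>
    intro i hi
    have zero1 := AddCommGrpCat.isZero_of_iff_subsingleton.mpr
      (ih (hg.mono r.le_succ) i (by omega))
    have zero2 := AddCommGrpCat.isZero_of_iff_subsingleton.mpr
      (ih (hg.mono r.le_succ) (i + 1) (by omega))
    exact AddCommGrpCat.subsingleton_of_isZero <| ShortComplex.Exact.isZero_of_both_zeros
      ((Ext.covariant_sequence_exact₃' N (shortExact_mul_factor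
        (initialSpan_succ g r) (hg r r.lt_succ_self))) i (i + 1) rfl)
      (zero1.eq_zero_of_src _) (zero2.eq_zero_of_tgt _)

/-- If an `R`-regular sequence of length `n` lies in the proper ideal `I`, then `I` contains a
nonzerodivisor modulo any weakly regular sequence of length less than `n`. -/
lemma exists_mem_isSMulRegular_quotient [IsNoetherianRing R] {I : Ideal R} (hI : I ≠ ⊤)
    {rs : List R} (mem : ∀ r ∈ rs, r ∈ I) (reg : RingTheory.Sequence.IsRegular R rs)
    {g : ℕ → R} {r : ℕ} (hr : r < rs.length) (hg : IsRegularUpTo g r) :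
    ∃ x ∈ I, IsSMulRegular (R ⧸ initialSpan g r) x := by
  have hExt := ModuleCat.subsingleton_ext_of_exists_isRegular I (ModuleCat.of R (R ⧸ I))
    (by
      rw [Module.support_eq_zeroLocus]
      exact (congrArg (fun J : Ideal R => PrimeSpectrum.zeroLocus (J : Set R))
        Ideal.annihilator_quotient).subset)
    (ModuleCat.of R R) (by simpa [lt_top_iff_ne_top] using hI) rs mem reg
  have h0 := subsingleton_ext_quotient _ hExt hg 0 (by omega)
  have h1 : Subsingleton ((R ⧸ I) →ₗ[R] (R ⧸ initialSpan g r)) :=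
    (Ext.addEquiv₀.trans (ModuleCat.homAddEquiv (M := ModuleCat.of R (R ⧸ I))
      (N := ModuleCat.of R (R ⧸ initialSpan g r)))).symm.subsingleton
  obtain ⟨x, hx, hreg⟩ := IsSMulRegular.subsingleton_linearMap_iff.mp h1
  exact ⟨x, by rwa [Ideal.annihilator_quotient] at hx, hreg⟩

end Depth

section Monomials

variable {K : Type*} [Field K] {m : ℕ}

/-- The sequence `X₀ ^ e₀, …, X_{m-1} ^ e_{m-1}, 0, 0, …`. -/
noncomputable def varPow (K : Type*) [Field K] (m : ℕ) (e : ℕ → ℕ) (i : ℕ) :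
    MvPolynomial (Fin m) K :=
  if h : i < m then X ⟨i, h⟩ ^ e i else 0

lemma mem_initialSpan_varPow {e : ℕ → ℕ} {r : ℕ} (hr : r ≤ m) {q : MvPolynomial (Fin m) K} :
    q ∈ initialSpan (varPow K m e) r ↔
      ∀ a ∈ q.support, ∃ i : Fin m, i.1 < r ∧ e i ≤ a i := by
  have h : varPow K m e '' Set.Iio r = (fun a => monomial a (1 : K)) ''
      ((fun i : Fin m => Finsupp.single i (e i)) '' {i | i.1 < r}) := by
    ext p
    simp only [Set.mem_image, Set.mem_Iio, Set.mem_ofPred_eq, exists_exists_and_eq_and]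
    constructor
    · rintro ⟨i, hi, rfl⟩
      exact ⟨⟨i, hi.trans_le hr⟩, hi, by simp [varPow, hi.trans_le hr, X_pow_eq_monomial]⟩
    · rintro ⟨i, hi, rfl⟩
      exact ⟨i, hi, by simp [varPow, X_pow_eq_monomial]⟩
  rw [initialSpan, h, mem_ideal_span_monomial_image]
  simp

lemma isRegularUpTo_varPow (e : ℕ → ℕ) : IsRegularUpTo (varPow K m e) m := by
  intro r hr u hu
  rw [mem_initialSpan_varPow hr.le] at hu ⊢
  intro a ha
  have hmem : Finsupp.single ⟨r, hr⟩ (e r) + a ∈ (varPow K m e r * u).support := by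
    rw [mem_support_iff] at ha ⊢
    rw [varPow, dif_pos hr, X_pow_eq_monomial, coeff_monomial_mul]
    simpa using ha
  obtain ⟨i, hi, hle⟩ := hu _ hmem
  refine ⟨i, hi, ?_⟩
  have hne : (⟨r, hr⟩ : Fin m) ≠ i := by
    rintro rfl
    exact lt_irrefl _ hi
  simpa [Finsupp.single_apply, hne] using hle

lemma isHomogeneous_varPow (e : ℕ → ℕ) (i : ℕ) : (varPow K m e i).IsHomogeneous (e i) := by
  unfold varPow
  split_ifs with h
  · exact isHomogeneous_X_pow _ _
  · exact isHomogeneous_zero _ _ _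

lemma homogeneous_mem_initialSpan_varPow {e : ℕ → ℕ} {t : ℕ}
    (ht : ∑ i ∈ Finset.range m, (e i - 1) < t) {q : MvPolynomial (Fin m) K}
    (hq : q.IsHomogeneous t) : q ∈ initialSpan (varPow K m e) m := by
  rw [mem_initialSpan_varPow le_rfl]
  intro a ha
  by_contra! hlt
  have h1 : a.degree = t := by
    by_contra h
    exact mem_support_iff.mp ha (hq.coeff_eq_zero h)
  rw [Finsupp.degree_eq_sum] at h1
  have h2 : ∑ i : Fin m, a i ≤ ∑ i : Fin m, (e i - 1) :=
    Finset.sum_le_sum fun i _ => by have := hlt i i.2; omega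
  rw [Finset.sum_range] at ht
  omega

lemma isRegular_X (K : Type*) [Field K] (m : ℕ) : RingTheory.Sequence.IsRegular
    (MvPolynomial (Fin m) K) ((List.range m).map (varPow K m 1)) := by
  have key (i : ℕ) (hi : i ≤ m) : Ideal.ofList (((List.range m).map (varPow K m 1)).take i) =
      initialSpan (varPow K m 1) i := by
    rw [Ideal.ofList, initialSpan, ← List.map_take, List.take_range, min_eq_left hi]
    congr 1
    ext p
    simp
  refine ⟨⟨fun i hi => ?_⟩, ?_⟩
  · simp only [List.length_map, List.length_range] at hi
    rw [key i hi.le, isSMulRegular_quotient_iff_mem_of_smul_mem]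
    simpa using isRegularUpTo_varPow 1 i hi
  · have := key m le_rfl
    rw [List.take_of_length_le (by simp)] at this
    rw [this]
    intro h
    have h1 : (1 : MvPolynomial (Fin m) K) ∈ initialSpan (varPow K m 1) m := by
      have : (1 : MvPolynomial (Fin m) K) ∈ (⊤ : Ideal (MvPolynomial (Fin m) K)) := trivial
      rw [h] at this
      simpa using this
    obtain ⟨i, -, hi⟩ := (mem_initialSpan_varPow le_rfl).mp h1 0 (by simp)
    simp at hi

end Monomials

section HilbertFunction

variable {K : Type*} [Field K] {m : ℕ}

/-- The degree `t` part of the ideal generated by the first `r` terms of `G`. -/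
noncomputable def initialSpanDegree (G : ℕ → MvPolynomial (Fin m) K) (r t : ℕ) :
    Submodule K (MvPolynomial (Fin m) K) :=
  homogeneousSubmodule (Fin m) K t ⊓ (initialSpan G r).restrictScalars K

instance (t : ℕ) : FiniteDimensional K (homogeneousSubmodule (Fin m) K t) :=
  Module.Finite.iff_fg.mpr (homogeneousSubmodule_fg (Fin m) K t)

lemma homogeneousComponent_homogeneous_mul {σ : Type*} {G : MvPolynomial σ K} {e : ℕ}
    (hG : G.IsHomogeneous e) (p : MvPolynomial σ K) (k : ℕ) :
    homogeneousComponent (e + k) (G * p) = G * homogeneousComponent k p := by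
  conv_lhs => rw [← sum_homogeneousComponent p, Finset.mul_sum, map_sum]
  have h (i : ℕ) : homogeneousComponent (e + k) (G * homogeneousComponent i p) =
      if k = i then G * homogeneousComponent i p else 0 := by
    rw [homogeneousComponent_of_mem (hG.mul (homogeneousComponent_isHomogeneous i p))]
    simp
  simp_rw [h]
  rw [Finset.sum_ite_eq]
  split_ifs with hk
  · rfl
  · rw [homogeneousComponent_eq_zero k p (by simpa using hk), mul_zero]

lemma homogeneousComponent_homogeneous_mul_of_lt {σ : Type*} {G : MvPolynomial σ K} {e : ℕ}
    (hG : G.IsHomogeneous e) (p : MvPolynomial σ K) {t : ℕ} (ht : t < e) :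
    homogeneousComponent t (G * p) = 0 := by
  rw [← sum_homogeneousComponent p, Finset.mul_sum, map_sum]
  refine Finset.sum_eq_zero fun i _ => ?_
  rw [homogeneousComponent_of_mem (hG.mul (homogeneousComponent_isHomogeneous i p)),
    if_neg (by omega)]

lemma homogeneousComponent_mem_initialSpan {G : ℕ → MvPolynomial (Fin m) K} {e : ℕ → ℕ} {r : ℕ}
    (hG : ∀ i < r, (G i).IsHomogeneous (e i)) {q : MvPolynomial (Fin m) K}
    (hq : q ∈ initialSpan G r) (t : ℕ) : homogeneousComponent t q ∈ initialSpan G r := by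
  induction r generalizing q with
  | zero => simp_all
  | succ r ih =>
    obtain ⟨b, hb⟩ := mem_initialSpan_succ.mp hq
    have h := ih (fun i hi => hG i (hi.trans r.lt_succ_self)) hb
    rw [map_sub] at h
    rw [mem_initialSpan_succ]
    obtain ht | hk := lt_or_ge t (e r)
    · refine ⟨0, ?_⟩
      rwa [homogeneousComponent_homogeneous_mul_of_lt (hG r r.lt_succ_self) b ht, ← mul_zero (G r)]
        at h
    · obtain ⟨k, rfl⟩ := Nat.exists_eq_add_of_le hk
      exact ⟨_, by rwa [homogeneousComponent_homogeneous_mul (hG r r.lt_succ_self)] at h⟩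

lemma initialSpanDegree_succ_of_lt {G : ℕ → MvPolynomial (Fin m) K} {e : ℕ → ℕ} {r t : ℕ}
    (hG : ∀ i < r + 1, (G i).IsHomogeneous (e i)) (ht : t < e r) :
    initialSpanDegree G (r + 1) t = initialSpanDegree G r t := by
  refine le_antisymm ?_ (inf_le_inf_left _ ?_)
  · intro q hq
    refine ⟨hq.1, ?_⟩
    obtain ⟨b, hb⟩ := mem_initialSpan_succ.mp hq.2
    have h := homogeneousComponent_mem_initialSpan
      (fun i hi => hG i (hi.trans r.lt_succ_self)) hb t
    rwa [map_sub, homogeneousComponent_homogeneous_mul_of_lt (hG r r.lt_succ_self) b ht,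
      sub_zero, homogeneousComponent_eq_self hq.1] at h
  · rw [initialSpan_succ]
    exact fun q hq => Ideal.mem_sup_right hq

lemma initialSpanDegree_succ {G : ℕ → MvPolynomial (Fin m) K} {e : ℕ → ℕ} {r : ℕ}
    (hG : ∀ i < r + 1, (G i).IsHomogeneous (e i)) (k : ℕ) :
    initialSpanDegree G (r + 1) (e r + k) = initialSpanDegree G r (e r + k) ⊔
      (homogeneousSubmodule (Fin m) K k).map (LinearMap.mulLeft K (G r)) := by
  apply le_antisymm
  · intro q hq
    obtain ⟨b, hb⟩ := mem_initialSpan_succ.mp hq.2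
    have h := homogeneousComponent_mem_initialSpan
      (fun i hi => hG i (hi.trans r.lt_succ_self)) hb (e r + k)
    rw [map_sub, homogeneousComponent_homogeneous_mul (hG r r.lt_succ_self) b,
      homogeneousComponent_eq_self hq.1] at h
    refine Submodule.mem_sup.mpr ⟨_, ⟨?_, h⟩, _,
      ⟨_, homogeneousComponent_mem k b, rfl⟩, sub_add_cancel _ _⟩
    exact hq.1.sub ((hG r r.lt_succ_self).mul (homogeneousComponent_isHomogeneous k b))
  · refine sup_le (inf_le_inf_left _ ?_) ?_
    · rw [initialSpan_succ]
      exact fun q hq => Ideal.mem_sup_right hq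
    · rintro _ ⟨b, hb, rfl⟩
      exact ⟨(hG r r.lt_succ_self).mul hb,
        Ideal.mul_mem_right _ _ (mem_initialSpan r.lt_succ_self)⟩

lemma initialSpanDegree_inf {G : ℕ → MvPolynomial (Fin m) K} {e : ℕ → ℕ} {r : ℕ}
    (hG : (G r).IsHomogeneous (e r))
    (hreg : ∀ u, G r * u ∈ initialSpan G r → u ∈ initialSpan G r) (k : ℕ) :
    initialSpanDegree G r (e r + k) ⊓
      (homogeneousSubmodule (Fin m) K k).map (LinearMap.mulLeft K (G r)) =
      (initialSpanDegree G r k).map (LinearMap.mulLeft K (G r)) := by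
  apply le_antisymm
  · rintro _ ⟨⟨-, h⟩, b, hb, rfl⟩
    exact ⟨b, ⟨hb, hreg b h⟩, rfl⟩
  · rintro _ ⟨b, hb, rfl⟩
    exact ⟨⟨hG.mul hb.1, Ideal.mul_mem_left _ _ hb.2⟩, b, hb.1, rfl⟩

lemma finrank_initialSpanDegree_succ {G : ℕ → MvPolynomial (Fin m) K} {e : ℕ → ℕ} {r : ℕ}
    (hG : ∀ i < r + 1, (G i).IsHomogeneous (e i)) (hG0 : G r ≠ 0)
    (hreg : ∀ u, G r * u ∈ initialSpan G r → u ∈ initialSpan G r) (k : ℕ) :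
    Module.finrank K (initialSpanDegree G (r + 1) (e r + k)) +
        Module.finrank K (initialSpanDegree G r k) =
      Module.finrank K (initialSpanDegree G r (e r + k)) +
        Module.finrank K (homogeneousSubmodule (Fin m) K k) := by
  have hinj : Function.Injective (LinearMap.mulLeft K (G r)) := mul_right_injective₀ hG0
  have : FiniteDimensional K (initialSpanDegree G r (e r + k)) :=
    Submodule.finiteDimensional_of_le inf_le_left
  rw [initialSpanDegree_succ hG,
    (Submodule.equivMapOfInjective _ hinj (initialSpanDegree G r k)).finrank_eq,
    ← initialSpanDegree_inf (hG r r.lt_succ_self) hreg,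
    Submodule.finrank_sup_add_finrank_inf_eq,
    (Submodule.equivMapOfInjective _ hinj (homogeneousSubmodule (Fin m) K k)).finrank_eq]

/-- The Hilbert function of the ideal generated by a homogeneous regular sequence depends only on
the degrees of the generators. -/
lemma finrank_initialSpanDegree_eq {G G' : ℕ → MvPolynomial (Fin m) K} {e : ℕ → ℕ} {n : ℕ}
    (hG : ∀ i < n, (G i).IsHomogeneous (e i)) (hG' : ∀ i < n, (G' i).IsHomogeneous (e i))
    (hG0 : ∀ i < n, G i ≠ 0) (hG0' : ∀ i < n, G' i ≠ 0)
    (hreg : IsRegularUpTo G n) (hreg' : IsRegularUpTo G' n) (t : ℕ) :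
    Module.finrank K (initialSpanDegree G n t) = Module.finrank K (initialSpanDegree G' n t) := by
  induction n generalizing t with
  | zero => rw [initialSpanDegree, initialSpanDegree, initialSpan_zero, initialSpan_zero]
  | succ n ih =>
    have hn := n.lt_succ_self
    replace ih := ih (fun i hi => hG i (hi.trans hn)) (fun i hi => hG' i (hi.trans hn))
      (fun i hi => hG0 i (hi.trans hn)) (fun i hi => hG0' i (hi.trans hn))
      (hreg.mono hn.le) (hreg'.mono hn.le)
    obtain ht | hk := lt_or_ge t (e n)
    · rw [initialSpanDegree_succ_of_lt hG ht, initialSpanDegree_succ_of_lt hG' ht, ih]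
    · obtain ⟨k, rfl⟩ := Nat.exists_eq_add_of_le hk
      have h := finrank_initialSpanDegree_succ hG (hG0 n hn) (hreg n hn) k
      have h' := finrank_initialSpanDegree_succ hG' (hG0' n hn) (hreg' n hn) k
      have := ih k
      have := ih (e n + k)
      omega

/-- Macaulay's bound: the quotient by a maximal homogeneous regular sequence vanishes in degrees
above `∑ (eᵢ - 1)`. -/
lemma homogeneous_mem_initialSpan {G : ℕ → MvPolynomial (Fin m) K} {e : ℕ → ℕ}
    (hG : ∀ i < m, (G i).IsHomogeneous (e i)) (hG0 : ∀ i < m, G i ≠ 0)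
    (hreg : IsRegularUpTo G m) {t : ℕ} (ht : ∑ i ∈ Finset.range m, (e i - 1) < t)
    {q : MvPolynomial (Fin m) K} (hq : q.IsHomogeneous t) : q ∈ initialSpan G m := by
  have h := finrank_initialSpanDegree_eq hG (fun i _ => isHomogeneous_varPow e i) hG0
    (fun i hi => by simp [varPow, hi]) hreg (isRegularUpTo_varPow e) t
  have h' : initialSpanDegree (varPow K m e) m t = homogeneousSubmodule (Fin m) K t :=
    inf_eq_left.mpr fun q hq => homogeneous_mem_initialSpan_varPow ht hq
  rw [h'] at h
  have := Submodule.eq_of_le_of_finrank_eq (inf_le_left : initialSpanDegree G m t ≤ _) h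
  rw [← mem_homogeneousSubmodule, ← this] at hq
  exact hq.2

end HilbertFunction

section Filtration

variable {K : Type*} [Field K] {m : ℕ}

/-- The span of the products `g i * p` with `i < r` and `deg p + e i ≤ d`. -/
noncomputable def truncatedSpan (g : ℕ → MvPolynomial (Fin m) K) (e : ℕ → ℕ) (r d : ℕ) :
    Submodule K (MvPolynomial (Fin m) K) :=
  Submodule.span K {q | ∃ i < r, ∃ p : MvPolynomial (Fin m) K,
    p.totalDegree + e i ≤ d ∧ q = g i * p}

lemma truncatedSpan_mono {g : ℕ → MvPolynomial (Fin m) K} {e : ℕ → ℕ} {r r' d d' : ℕ}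
    (hr : r ≤ r') (hd : d ≤ d') : truncatedSpan g e r d ≤ truncatedSpan g e r' d' := by
  apply Submodule.span_mono
  rintro q ⟨i, hi, p, hp, rfl⟩
  exact ⟨i, hi.trans_le hr, p, hp.trans hd, rfl⟩

lemma truncatedSpan_le_initialSpan (g : ℕ → MvPolynomial (Fin m) K) (e : ℕ → ℕ) (r d : ℕ) :
    truncatedSpan g e r d ≤ (initialSpan g r).restrictScalars K := by
  rw [truncatedSpan, Submodule.span_le]
  rintro q ⟨i, hi, p, -, rfl⟩
  exact Ideal.mul_mem_right _ _ (mem_initialSpan hi)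

lemma truncatedSpan_le_restrictTotalDegree {g : ℕ → MvPolynomial (Fin m) K} {e : ℕ → ℕ} {r : ℕ}
    (hg : ∀ i < r, (g i).totalDegree ≤ e i) (d : ℕ) :
    truncatedSpan g e r d ≤ restrictTotalDegree (Fin m) K d := by
  rw [truncatedSpan, Submodule.span_le]
  rintro q ⟨i, hi, p, hp, rfl⟩
  rw [SetLike.mem_coe, mem_restrictTotalDegree]
  have := totalDegree_mul (g i) p
  have := hg i hi
  omega

lemma eq_zero_or_totalDegree_lt {σ : Type*} {b : MvPolynomial σ K} {n : ℕ}
    (hb : b.totalDegree ≤ n) (h : homogeneousComponent n b = 0) :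
    b = 0 ∨ b.totalDegree < n := by
  by_contra! hc
  obtain ⟨h0, hn⟩ := hc
  have hne : b.support.Nonempty := support_nonempty.mpr h0
  obtain ⟨a, ha, hmax⟩ := Finset.exists_mem_eq_sup b.support hne fun a => a.degree
  have hdeg : a.degree = n := by
    rw [← hmax]
    exact le_antisymm hb hn
  have := congrArg (coeff a) h
  rw [coeff_homogeneousComponent, if_pos hdeg] at this
  exact mem_support_iff.mp ha (by simpa using this)

lemma homogeneousComponent_mul {σ : Type*} {g p : MvPolynomial σ K} {e k : ℕ}
    (hg : g.totalDegree ≤ e) (hp : p.totalDegree ≤ k) :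
    homogeneousComponent (e + k) (g * p) =
      homogeneousComponent e g * homogeneousComponent k p := by
  rw [← homogeneousComponent_homogeneous_mul (homogeneousComponent_isHomogeneous e g),
    ← sub_eq_zero, ← map_sub, ← sub_mul]
  obtain h | h := eq_zero_or_totalDegree_lt (b := g - homogeneousComponent e g) (n := e)
    ((totalDegree_sub _ _).trans
      (max_le hg (homogeneousComponent_isHomogeneous e g).totalDegree_le))
    (by rw [map_sub, homogeneousComponent_eq_self (homogeneousComponent_isHomogeneous e g),
      sub_self])
  · rw [h, zero_mul, map_zero]
  · apply homogeneousComponent_eq_zero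
    have := totalDegree_mul (g - homogeneousComponent e g) p
    omega

lemma homogeneousComponent_mem_of_mem_truncatedSpan {g : ℕ → MvPolynomial (Fin m) K} {e : ℕ → ℕ}
    {r : ℕ} (hg : ∀ i < r, (g i).totalDegree ≤ e i) {d : ℕ} {q : MvPolynomial (Fin m) K}
    (hq : q ∈ truncatedSpan g e r d) :
    homogeneousComponent d q ∈ initialSpan (fun i => homogeneousComponent (e i) (g i)) r := by
  suffices truncatedSpan g e r d ≤ ((initialSpan (fun i => homogeneousComponent (e i) (g i))
      r).restrictScalars K).comap (homogeneousComponent d) from this hq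
  rw [truncatedSpan, Submodule.span_le]
  rintro q ⟨i, hi, p, hp, rfl⟩
  obtain ⟨k, rfl⟩ := Nat.exists_eq_add_of_le (le_of_add_le_right hp)
  change homogeneousComponent (e i + k) (g i * p) ∈ initialSpan _ r
  rw [homogeneousComponent_mul (hg i hi) (by omega)]
  exact Ideal.mul_mem_right _ _ (mem_initialSpan hi)

/-- Every form in the ideal of leading forms lifts to the filtered ideal. -/
lemma exists_mem_truncatedSpan_homogeneousComponent_eq {g : ℕ → MvPolynomial (Fin m) K}
    {e : ℕ → ℕ} {r : ℕ} (hg : ∀ i < r, (g i).totalDegree ≤ e i) (t : ℕ)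
    {q : MvPolynomial (Fin m) K}
    (hq : q ∈ initialSpan (fun i => homogeneousComponent (e i) (g i)) r) :
    ∃ w ∈ truncatedSpan g e r t, homogeneousComponent t w = homogeneousComponent t q := by
  induction r generalizing q with
  | zero => exact ⟨0, zero_mem _, by simp_all⟩
  | succ r ih =>
    obtain ⟨b, hb⟩ := mem_initialSpan_succ.mp hq
    obtain ⟨w, hw, hwt⟩ := ih (fun i hi => hg i (hi.trans r.lt_succ_self)) hb
    have hhom := homogeneousComponent_isHomogeneous (e r) (g r)
    replace hw := truncatedSpan_mono r.le_succ le_rfl hw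
    obtain ht | hk := lt_or_ge t (e r)
    · refine ⟨w, hw, ?_⟩
      rw [hwt, map_sub, homogeneousComponent_homogeneous_mul_of_lt hhom b ht, sub_zero]
    · obtain ⟨k, rfl⟩ := Nat.exists_eq_add_of_le hk
      have hbk := homogeneousComponent_isHomogeneous k b
      refine ⟨w + g r * homogeneousComponent k b, add_mem hw (Submodule.subset_span
        ⟨r, r.lt_succ_self, _, by have := hbk.totalDegree_le; omega, rfl⟩), ?_⟩
      rw [map_add, hwt, map_sub, homogeneousComponent_homogeneous_mul hhom,
        homogeneousComponent_mul (hg r r.lt_succ_self) hbk.totalDegree_le,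
        homogeneousComponent_eq_self hbk, sub_add_cancel]

/-- Subtracting an element of the filtered ideal kills a top form lying in the ideal of leading
forms. -/
lemma exists_sub_totalDegree_lt {g : ℕ → MvPolynomial (Fin m) K}
    {e : ℕ → ℕ} {r : ℕ} (hg : ∀ i < r, (g i).totalDegree ≤ e i) {n : ℕ}
    {b : MvPolynomial (Fin m) K} (hbn : b.totalDegree ≤ n)
    (hb : homogeneousComponent n b ∈ initialSpan (fun i => homogeneousComponent (e i) (g i)) r) :
    ∃ w ∈ initialSpan g r, b - w = 0 ∨ (b - w).totalDegree < n := by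
  obtain ⟨w, hw, hwn⟩ := exists_mem_truncatedSpan_homogeneousComponent_eq hg n hb
  rw [homogeneousComponent_eq_self (homogeneousComponent_isHomogeneous n b)] at hwn
  refine ⟨w, truncatedSpan_le_initialSpan g e r n hw,
    eq_zero_or_totalDegree_lt ?_ (by rw [map_sub, hwn, sub_self])⟩
  have := (mem_restrictTotalDegree _ _ _).mp (truncatedSpan_le_restrictTotalDegree hg n hw)
  exact (totalDegree_sub _ _).trans (max_le hbn this)

/-- If the leading forms of `g` form a regular sequence, then the ideal generated by `g`, truncated
in degree `d`, is spanned by the products of degree at most `d`. -/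
lemma mem_truncatedSpan_of_mem_initialSpan {g : ℕ → MvPolynomial (Fin m) K} {e : ℕ → ℕ} {n : ℕ}
    (hg : ∀ i < n, (g i).totalDegree ≤ e i)
    (hreg : IsRegularUpTo (fun i => homogeneousComponent (e i) (g i)) n)
    {d : ℕ} {q : MvPolynomial (Fin m) K} (hq : q ∈ initialSpan g n) (hqd : q.totalDegree ≤ d) :
    q ∈ truncatedSpan g e n d := by
  induction n generalizing d q with
  | zero =>
    rw [initialSpan_zero, Ideal.mem_bot] at hq
    exact hq ▸ zero_mem _
  | succ r ih =>
    have hgr := hg r r.lt_succ_self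
    replace ih {d q} := @ih (fun i hi => hg i (hi.trans r.lt_succ_self)) (hreg.mono r.le_succ) d q
    have key (n : ℕ) : ∀ b : MvPolynomial (Fin m) K, (b = 0 ∨ b.totalDegree < n) →
        q - g r * b ∈ initialSpan g r → q ∈ truncatedSpan g e (r + 1) d := by
      induction n with
      | zero =>
        rintro b (rfl | hb) h
        · rw [mul_zero, sub_zero] at h
          exact truncatedSpan_mono r.le_succ le_rfl (ih h hqd)
        · omega
      | succ n ihn =>
        intro b hb h
        have hbn : b.totalDegree ≤ n := by
          obtain rfl | hb := hb
          · simp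
          · omega
        have hmul := totalDegree_mul (g r) b
        have hsub := totalDegree_sub q (g r * b)
        obtain hle | hlt := le_or_gt (e r + n) d
        · have h1 := truncatedSpan_mono r.le_succ le_rfl
            (ih h (hsub.trans (max_le hqd (by omega))))
          rw [← sub_add_cancel q (g r * b)]
          exact add_mem h1 (Submodule.subset_span ⟨r, r.lt_succ_self, b, by omega, rfl⟩)
        · have h1 := homogeneousComponent_mem_of_mem_truncatedSpan
            (fun i hi => hg i (hi.trans r.lt_succ_self))
            (ih (d := e r + n) h (hsub.trans (max_le (by omega) (by omega))))
          rw [map_sub, homogeneousComponent_mul hgr hbn,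
            homogeneousComponent_eq_zero _ q (by omega), zero_sub, neg_mem_iff] at h1
          obtain ⟨w, hw, hbw⟩ := exists_sub_totalDegree_lt
            (fun i hi => hg i (hi.trans r.lt_succ_self)) hbn (hreg r r.lt_succ_self _ h1)
          refine ihn (b - w) hbw ?_
          convert add_mem h (Ideal.mul_mem_left _ (g r) hw) using 1
          ring
    obtain ⟨b, hb⟩ := mem_initialSpan_succ.mp hq
    exact key (b.totalDegree + 1) b (Or.inr (Nat.lt_succ_self _)) hb

/-- Modulo polynomials whose leading forms are a maximal homogeneous regular sequence, every
polynomial is congruent to one of degree at most `∑ (eᵢ - 1)`. -/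
lemma exists_sub_totalDegree_le {g : ℕ → MvPolynomial (Fin m) K} {e : ℕ → ℕ}
    (hg : ∀ i < m, (g i).totalDegree ≤ e i)
    (hg0 : ∀ i < m, homogeneousComponent (e i) (g i) ≠ 0)
    (hreg : IsRegularUpTo (fun i => homogeneousComponent (e i) (g i)) m)
    (b : MvPolynomial (Fin m) K) :
    ∃ w ∈ initialSpan g m, (b - w).totalDegree ≤ ∑ i ∈ Finset.range m, (e i - 1) := by
  induction hn : b.totalDegree using Nat.strong_induction_on generalizing b with
  | _ n ih =>
    obtain hle | hlt := le_or_gt n (∑ i ∈ Finset.range m, (e i - 1))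
    · exact ⟨0, zero_mem _, by simpa [hn] using hle⟩
    · obtain ⟨w, hw, hbw⟩ := exists_sub_totalDegree_lt hg hn.le
        (homogeneous_mem_initialSpan (fun i _ => homogeneousComponent_isHomogeneous _ _) hg0 hreg
          hlt (homogeneousComponent_isHomogeneous n b))
      obtain hbw | hbw := hbw
      · exact ⟨w, hw, by simp [hbw]⟩
      · obtain ⟨w', hw', h⟩ := ih _ hbw _ rfl
        exact ⟨w + w', add_mem hw hw', by rwa [← sub_sub]⟩

end Filtration

section Triangular

variable {K : Type*} [Field K] {m s : ℕ}

/-- The coefficient vectors `p` of combinations `∑ⱼ pⱼ Fⱼ` with `j ≥ i` that are homogeneous of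
degree `e i` whenever each `Fⱼ` is homogeneous of degree `e j`. -/
noncomputable def coeffSubmodule (K : Type*) [Field K] (m s : ℕ) (e : ℕ → ℕ) (i : ℕ) :
    Submodule K (Fin s → MvPolynomial (Fin m) K) where
  carrier := {p | (∀ j : Fin s, j.1 < i → p j = 0) ∧ ∀ j, (p j).IsHomogeneous (e i - e j)}
  add_mem' hp hq := ⟨fun j hj => by simp [hp.1 j hj, hq.1 j hj], fun j => (hp.2 j).add (hq.2 j)⟩
  zero_mem' := ⟨fun _ _ => rfl, fun _ => isHomogeneous_zero _ _ _⟩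
  smul_mem' c _ hp := ⟨fun j hj => by simp [hp.1 j hj],
    fun j => (homogeneousSubmodule (Fin m) K _).smul_mem c (hp.2 j)⟩

lemma single_mem_coeffSubmodule {e : ℕ → ℕ} {i : ℕ} {j : Fin s} (hj : i ≤ j)
    {p : MvPolynomial (Fin m) K} (hp : p.IsHomogeneous (e i - e j)) :
    Pi.single j p ∈ coeffSubmodule K m s e i := by
  refine ⟨fun k hk => by rw [Pi.single_eq_of_ne]; rintro rfl; omega, fun k => ?_⟩
  obtain rfl | hne := eq_or_ne k j
  · rwa [Pi.single_eq_same]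
  · rw [Pi.single_eq_of_ne hne]
    exact isHomogeneous_zero _ _ _

lemma mem_of_triangular {A : Ideal (MvPolynomial (Fin m) K)} {n : ℕ} {e : ℕ → ℕ}
    {f : Fin s → MvPolynomial (Fin m) K} {P : ℕ → Fin s → MvPolynomial (Fin m) K}
    (hP : ∀ i < n, P i ∈ coeffSubmodule K m s e i) (hP0 : ∀ i : Fin s, i.1 < n → P i i ≠ 0)
    (hA : ∀ i < n, ∑ j, P i j * f j ∈ A) (hf : ∀ j : Fin s, n ≤ j → f j ∈ A) (j : Fin s) :
    f j ∈ A := by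
  induction hk : s - j using Nat.strong_induction_on generalizing j with
  | _ k ih =>
    obtain hj | hj := le_or_gt n j
    · exact hf j hj
    have hhom := (hP j hj).2 j
    rw [Nat.sub_self] at hhom
    have hunit : IsUnit (P j j) := by
      have hC := totalDegree_eq_zero_iff_eq_C.mp (Nat.le_zero.mp hhom.totalDegree_le)
      rw [hC]
      refine (IsUnit.mk0 _ fun h => hP0 j hj ?_).map C
      rw [hC, h, map_zero]
    rw [← Ideal.unit_mul_mem_iff_mem A hunit]
    have hsum := hA j hj
    rw [← Finset.add_sum_erase _ _ (Finset.mem_univ j)] at hsum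
    refine (Ideal.add_mem_iff_left A (Ideal.sum_mem A fun l hl => ?_)).mp hsum
    obtain hlj | hlj := lt_or_ge l.1 j.1
    · rw [(hP j hj).1 l hlj, zero_mul]
      exact zero_mem _
    · have hne : l.1 ≠ j.1 := fun h => Finset.ne_of_mem_erase hl (Fin.ext h)
      exact Ideal.mul_mem_left _ _ (ih _ (by omega) l rfl)

variable [IsAlgClosed K]

/-- A prime ideal missing some polynomial that vanishes at the origin has a nonzero zero. -/
lemma exists_ne_zero_of_notMem {Q : Ideal (MvPolynomial (Fin m) K)} [Q.IsPrime]
    {x : MvPolynomial (Fin m) K} (hx : eval 0 x = 0) (hxQ : x ∉ Q) :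
    ∃ y ≠ 0, ∀ p ∈ Q, eval y p = 0 := by
  by_contra! h
  refine hxQ ?_
  rw [← IsPrime.vanishingIdeal_zeroLocus (K := K) Q]
  intro y hy
  obtain rfl | hy0 := eq_or_ne y 0
  · simpa using hx
  · obtain ⟨p, hp, hpy⟩ := h y hy0
    exact absurd (by simpa using hy p hp) hpy

/-- A general homogeneous combination extends a regular sequence, by prime avoidance. -/
lemma exists_isSMulRegular_sum {e : ℕ → ℕ} {F : Fin s → MvPolynomial (Fin m) K}
    (hlead : ∀ y : Fin m → K, (∀ j, eval y (F j) = 0) → y = 0)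
    {r : ℕ} (hrm : r < m) (hrs : r < s) {P : ℕ → Fin s → MvPolynomial (Fin m) K}
    (hP : ∀ i < r, P i ∈ coeffSubmodule K m s e i) (hP0 : ∀ i : Fin s, i.1 < r → P i i ≠ 0)
    (hreg : IsRegularUpTo (fun i => ∑ j, P i j * F j) r) :
    ∃ p ∈ coeffSubmodule K m s e r, p ⟨r, hrs⟩ ≠ 0 ∧
      IsSMulRegular (MvPolynomial (Fin m) K ⧸ initialSpan (fun i => ∑ j, P i j * F j) r)
        (∑ j, p j * F j) := by
  set J := initialSpan (fun i => ∑ j, P i j * F j) r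
  obtain ⟨x, hx0, hxreg⟩ := exists_mem_isSMulRegular_quotient
    (I := RingHom.ker (eval (0 : Fin m → K))) (RingHom.ker_ne_top _)
    (by
      simp only [List.mem_map, List.mem_range, forall_exists_index, and_imp,
        forall_apply_eq_imp_iff₂, RingHom.mem_ker]
      intro i hi
      simp [varPow, hi])
    (isRegular_X K m) (by simpa using hrm) hreg
  have : Finite (associatedPrimes (MvPolynomial (Fin m) K) (MvPolynomial (Fin m) K ⧸ J)) :=
    associatedPrimes.finite _ _
  let φ : coeffSubmodule K m s e r →ₗ[K] MvPolynomial (Fin m) K :=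
    (∑ j, LinearMap.mulRight K (F j) ∘ₗ LinearMap.proj j) ∘ₗ Submodule.subtype _
  have hφ (p) : φ p = ∑ j, p.1 j * F j := by simp [φ]
  let ψ : coeffSubmodule K m s e r →ₗ[K] MvPolynomial (Fin m) K :=
    LinearMap.proj ⟨r, hrs⟩ ∘ₗ Submodule.subtype _
  let V : Option (associatedPrimes (MvPolynomial (Fin m) K) (MvPolynomial (Fin m) K ⧸ J)) →
      Submodule K (coeffSubmodule K m s e r) := fun o =>
    o.elim (LinearMap.ker ψ) fun Q => (Q.1.restrictScalars K).comap φ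
  have hV (o) : V o ≠ ⊤ := by
    rw [Ne, Submodule.eq_top_iff']
    intro htop
    obtain _ | ⟨Q, hQ⟩ := o
    · have := htop ⟨_, single_mem_coeffSubmodule (j := ⟨r, hrs⟩) le_rfl
        (by simpa using isHomogeneous_one (Fin m) K)⟩
      simp [V, ψ] at this
    · have hQp : Q.IsPrime := hQ.isPrime
      have hJQ : J ≤ Q := by
        have := IsAssociatedPrime.annihilator_le hQ
        rwa [Submodule.annihilator_top, Ideal.annihilator_quotient] at this
      have hxQ : x ∉ Q := by
        have := biUnion_associatedPrimes_eq_compl_regular (MvPolynomial (Fin m) K)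
          (MvPolynomial (Fin m) K ⧸ J)
        intro h
        have h' : x ∈ {r | IsSMulRegular (MvPolynomial (Fin m) K ⧸ J) r}ᶜ := by
          rw [← this]
          exact Set.mem_biUnion hQ h
        exact h' hxreg
      obtain ⟨y, hy0, hy⟩ := exists_ne_zero_of_notMem hx0 hxQ
      refine hy0 (hlead y fun j => ?_)
      obtain ⟨k, hk⟩ := Function.ne_iff.mp hy0
      refine mem_of_triangular (A := RingHom.ker (eval y)) hP hP0
        (fun i hi => hy _ (hJQ (mem_initialSpan (g := fun i => ∑ j, P i j * F j) hi)))
        (fun j hj => ?_) j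
      have h1 : φ ⟨_, single_mem_coeffSubmodule hj (isHomogeneous_X_pow k (e r - e j))⟩ ∈ Q :=
        htop _
      have h2 := hy _ h1
      rw [hφ] at h2
      simp only [Pi.single_apply, ite_mul, zero_mul, Finset.sum_ite_eq', Finset.mem_univ, if_true,
        map_mul, map_pow, eval_X, mul_eq_zero] at h2
      exact h2.resolve_left (pow_ne_zero _ hk)
  obtain ⟨p, hp⟩ := Submodule.exists_forall_notMem_of_forall_ne_top V hV
  refine ⟨p.1, p.2, hp none, ?_⟩
  by_contra hc
  have : ∑ j, p.1 j * F j ∈ {r | IsSMulRegular (MvPolynomial (Fin m) K ⧸ J) r}ᶜ := hc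
  rw [← biUnion_associatedPrimes_eq_compl_regular, Set.mem_iUnion₂] at this
  obtain ⟨Q, hQ, h⟩ := this
  exact hp (some ⟨Q, hQ⟩) (by simpa [V, hφ] using h)

lemma exists_isRegularUpTo_sum {e : ℕ → ℕ} {F : Fin s → MvPolynomial (Fin m) K}
    (hlead : ∀ y : Fin m → K, (∀ j, eval y (F j) = 0) → y = 0) (hms : m ≤ s)
    {r : ℕ} (hr : r ≤ m) :
    ∃ P : ℕ → Fin s → MvPolynomial (Fin m) K, (∀ i < r, P i ∈ coeffSubmodule K m s e i) ∧
      (∀ i : Fin s, i.1 < r → P i i ≠ 0) ∧ IsRegularUpTo (fun i => ∑ j, P i j * F j) r := by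
  induction r with
  | zero => exact ⟨0, by simp, by simp, fun _ h => absurd h (by simp)⟩
  | succ r ih =>
    obtain ⟨P, hP, hP0, hreg⟩ := ih (by omega)
    obtain ⟨p, hp, hp0, hpreg⟩ := exists_isSMulRegular_sum hlead (by omega : r < m) (by omega)
      hP hP0 hreg
    have hne {i : ℕ} (hi : i < r) : Function.update P r p i = P i :=
      Function.update_of_ne hi.ne _ _
    refine ⟨Function.update P r p, fun i hi => ?_, fun i hi => ?_, fun i hi u hu => ?_⟩
    all_goals obtain hi | hi := (Nat.lt_succ_iff_lt_or_eq.mp hi)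
    · rw [hne hi]
      exact hP i hi
    · rwa [hi, Function.update_self]
    · rw [hne hi]
      exact hP0 i hi
    · subst hi
      simpa using hp0
    · exact hreg.congr (fun i hi => by rw [hne hi]) i hi u hu
    · subst hi
      rw [← initialSpan_congr (g := fun i => ∑ j, P i j * F j) fun l hl => by rw [hne hl]] at hu ⊢
      simp only [Function.update_self] at hu
      exact (isSMulRegular_quotient_iff_mem_of_smul_mem _ _).mp hpreg u hu

end Triangular

section FilteredSpan

variable {K : Type*} [Field K] {m s : ℕ}

/-- The span of the products `f i * p` with `deg p + e i ≤ d`. -/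
noncomputable def filteredSpan (f : Fin s → MvPolynomial (Fin m) K) (e : ℕ → ℕ) (d : ℕ) :
    Submodule K (MvPolynomial (Fin m) K) :=
  Submodule.span K {q | ∃ (i : Fin s) (p : MvPolynomial (Fin m) K),
    p.totalDegree + e i ≤ d ∧ q = f i * p}

lemma filteredSpan_le_span (f : Fin s → MvPolynomial (Fin m) K) (e : ℕ → ℕ) (d : ℕ) :
    filteredSpan f e d ≤ (Ideal.span (Set.range f)).restrictScalars K := by
  rw [filteredSpan, Submodule.span_le]
  rintro q ⟨i, p, -, rfl⟩
  exact Ideal.mul_mem_right _ _ (Ideal.subset_span ⟨i, rfl⟩)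

lemma filteredSpan_le_restrictTotalDegree {f : Fin s → MvPolynomial (Fin m) K} {e : ℕ → ℕ}
    (hf : ∀ i, (f i).totalDegree ≤ e i) (d : ℕ) :
    filteredSpan f e d ≤ restrictTotalDegree (Fin m) K d := by
  rw [filteredSpan, Submodule.span_le]
  rintro q ⟨i, p, hp, rfl⟩
  rw [SetLike.mem_coe, mem_restrictTotalDegree]
  have := totalDegree_mul (f i) p
  have := hf i
  omega

variable {f : Fin s → MvPolynomial (Fin m) K} {e : ℕ → ℕ}

lemma totalDegree_sum_mul_le (he : ∀ i j : Fin s, i ≤ j → e j ≤ e i)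
    (hf : ∀ i, (f i).totalDegree ≤ e i) {i : Fin s} {p : Fin s → MvPolynomial (Fin m) K}
    (hp : p ∈ coeffSubmodule K m s e i) : (∑ j, p j * f j).totalDegree ≤ e i := by
  refine totalDegree_finsetSum_le fun j _ => ?_
  obtain hj | hj := lt_or_ge j i
  · simp [hp.1 j hj]
  · have := totalDegree_mul (p j) (f j)
    have := (hp.2 j).totalDegree_le
    have := hf j
    have := he i j hj
    omega

lemma homogeneousComponent_sum_mul (he : ∀ i j : Fin s, i ≤ j → e j ≤ e i)
    {i : Fin s} {p : Fin s → MvPolynomial (Fin m) K} (hp : p ∈ coeffSubmodule K m s e i) :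
    homogeneousComponent (e i) (∑ j, p j * f j) =
      ∑ j, p j * homogeneousComponent (e j) (f j) := by
  rw [map_sum]
  refine Finset.sum_congr rfl fun j _ => ?_
  obtain hj | hj := lt_or_ge j i
  · simp [hp.1 j hj]
  · rw [← homogeneousComponent_homogeneous_mul (hp.2 j), Nat.sub_add_cancel (he i j hj)]

lemma truncatedSpan_sum_mul_le (he : ∀ i j : Fin s, i ≤ j → e j ≤ e i)
    {P : ℕ → Fin s → MvPolynomial (Fin m) K} {n : ℕ} (hn : n ≤ s)
    (hP : ∀ i < n, P i ∈ coeffSubmodule K m s e i) (d : ℕ) :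
    truncatedSpan (fun i => ∑ j, P i j * f j) e n d ≤ filteredSpan f e d := by
  rw [truncatedSpan, Submodule.span_le]
  rintro q ⟨i, hi, p, hp, rfl⟩
  rw [SetLike.mem_coe, Finset.sum_mul]
  refine Submodule.sum_mem _ fun j _ => ?_
  obtain hj | hj := lt_or_ge j.1 i
  · simp [(hP i hi).1 j hj]
  · refine Submodule.subset_span ⟨j, P i j * p, ?_, by ring⟩
    have := totalDegree_mul (P i j) p
    have := ((hP i hi).2 j).totalDegree_le
    have : e j ≤ e i := he ⟨i, by omega⟩ j hj
    omega

lemma ne_zero_of_isRegularUpTo {G : ℕ → MvPolynomial (Fin m) K} {n : ℕ}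
    (hG : ∀ i < n, (G i).IsHomogeneous (e i)) (he : ∀ i < n, e i ≠ 0)
    (hreg : IsRegularUpTo G n) : ∀ i < n, G i ≠ 0 := by
  intro i hi h0
  have h1 : (1 : MvPolynomial (Fin m) K) ∈ initialSpan G i :=
    hreg i hi 1 (by simp [h0])
  have hle : initialSpan G i ≤ RingHom.ker (constantCoeff (R := K) (σ := Fin m)) := by
    rw [initialSpan, Ideal.span_le]
    rintro _ ⟨l, hl, rfl⟩
    have hli : l < n := lt_trans hl hi
    rw [SetLike.mem_coe, RingHom.mem_ker, constantCoeff_eq]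
    exact (hG l hli).coeff_eq_zero (by simpa using (he l hli).symm)
  simpa using hle h1

end FilteredSpan

section FiniteQuotient

variable {K : Type*} [Field K] {V : Type*} [AddCommGroup V] [Module K V]

/-- If `W` meets every coset of `I` then `W` modulo `W ⊓ I` is all of the quotient by `I`. -/
noncomputable def quotientComapEquiv (W I N : Submodule K V)
    (hN : N.comap W.subtype = I.comap W.subtype)
    (h : ∀ v, ∃ w ∈ I, v - w ∈ W) : (W ⧸ N.comap W.subtype) ≃ₗ[K] (V ⧸ I) :=
  (Submodule.quotEquivOfEq _ _ (by rw [hN, LinearMap.ker_comp, Submodule.ker_mkQ])).trans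
    ((I.mkQ ∘ₗ W.subtype).quotKerEquivOfSurjective fun y => by
      obtain ⟨v, rfl⟩ := I.mkQ_surjective y
      obtain ⟨w, hw, hv⟩ := h v
      refine ⟨⟨v - w, hv⟩, ?_⟩
      simpa using hw)

end FiniteQuotient

section Main

variable {K : Type*} [Field K] [IsAlgClosed K] {m s : ℕ} {f : Fin s → MvPolynomial (Fin m) K}
  {e : ℕ → ℕ}

/-- A system without roots at infinity contains, up to a triangular change of generators, a system
of `m` polynomials whose leading forms are a regular sequence. -/
lemma exists_regular_subsystem (hs : m ≤ s) (he : ∀ i j : Fin s, i ≤ j → e j ≤ e i)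
    (he0 : ∀ i : Fin s, 1 ≤ e i) (hf : ∀ i, (f i).totalDegree ≤ e i)
    (hlead : ∀ x : Fin m → K,
      (∀ i : Fin s, eval x (homogeneousComponent (e i) (f i)) = 0) → x = 0) :
    ∃ g : ℕ → MvPolynomial (Fin m) K, (∀ i < m, (g i).totalDegree ≤ e i) ∧
      (∀ i < m, homogeneousComponent (e i) (g i) ≠ 0) ∧
      IsRegularUpTo (fun i => homogeneousComponent (e i) (g i)) m ∧
      (∀ d, truncatedSpan g e m d ≤ filteredSpan f e d) ∧
      Ideal.span (Set.range f) ≤ initialSpan g m ⊔ Ideal.span (f '' {j | m ≤ j.1}) := by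
  obtain ⟨P, hP, hP0, hreg⟩ := exists_isRegularUpTo_sum (e := e) hlead hs le_rfl
  have hG (i : ℕ) (hi : i < m) : homogeneousComponent (e i) (∑ j, P i j * f j) =
      ∑ j, P i j * homogeneousComponent (e j) (f j) :=
    homogeneousComponent_sum_mul (i := ⟨i, by omega⟩) he (hP i hi)
  have hreg' := hreg.congr fun i hi => (hG i hi).symm
  refine ⟨fun i => ∑ j, P i j * f j,
    fun i hi => totalDegree_sum_mul_le (i := ⟨i, by omega⟩) he hf (hP i hi),
    ne_zero_of_isRegularUpTo (fun i _ => homogeneousComponent_isHomogeneous _ _)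
      (fun i hi => Nat.one_le_iff_ne_zero.mp (he0 ⟨i, by omega⟩)) hreg', hreg',
    truncatedSpan_sum_mul_le he hs hP, ?_⟩
  rw [Ideal.span_le]
  rintro _ ⟨j, rfl⟩
  exact mem_of_triangular hP hP0
    (fun i hi => Ideal.mem_sup_left (mem_initialSpan (g := fun i => ∑ j, P i j * f j) hi))
    (fun j hj => Ideal.mem_sup_right (Ideal.subset_span (Set.mem_image_of_mem f hj))) j

lemma exists_sub_mem_and_mem_filteredSpan_iff (hs : m < s)
    (he : ∀ i j : Fin s, i ≤ j → e j ≤ e i)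
    (he0 : ∀ i : Fin s, 1 ≤ e i) (hf : ∀ i, (f i).totalDegree ≤ e i)
    (hlead : ∀ x : Fin m → K,
      (∀ i : Fin s, eval x (homogeneousComponent (e i) (f i)) = 0) → x = 0) {d : ℕ}
    (hd : ∑ i ∈ Finset.range m, (e i - 1) + e m ≤ d) :
    (∀ v, ∃ w ∈ Ideal.span (Set.range f), (v - w).totalDegree ≤ d) ∧
      ∀ q : MvPolynomial (Fin m) K, q.totalDegree ≤ d →
        (q ∈ filteredSpan f e d ↔ q ∈ Ideal.span (Set.range f)) := by
  obtain ⟨g, hg, hg0, hreg, hle, hspan⟩ := exists_regular_subsystem hs.le he he0 hf hlead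
  have hgI : initialSpan g m ≤ Ideal.span (Set.range f) := by
    rw [initialSpan, Ideal.span_le]
    rintro _ ⟨i, hi, rfl⟩
    have h : g i ∈ truncatedSpan g e m (e i) :=
      Submodule.subset_span ⟨i, hi, 1, by simp, by simp⟩
    exact filteredSpan_le_span f e _ (hle _ h)
  refine ⟨fun v => ?_, fun q hqd => ⟨fun h => filteredSpan_le_span f e d h, fun hq => ?_⟩⟩
  · obtain ⟨w, hw, h⟩ := exists_sub_totalDegree_le hg hg0 hreg v
    exact ⟨w, hgI hw, by omega⟩
  · obtain ⟨a, ha, b, hb, rfl⟩ := Submodule.mem_sup.mp (hspan hq)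
    rw [Set.image_eq_range, Ideal.mem_span_range_iff_exists_fun] at hb
    obtain ⟨c, rfl⟩ := hb
    choose w hw hcw using fun j => exists_sub_totalDegree_le hg hg0 hreg (c j)
    have hfil : ∑ j, (c j - w j) * f j ∈ filteredSpan f e d := by
      refine Submodule.sum_mem _ fun j _ => Submodule.subset_span ⟨j, _, ?_, mul_comm _ _⟩
      have : e j ≤ e m := he ⟨m, hs⟩ j j.2
      have := hcw j
      omega
    have hsum : a + ∑ j, c j * f j = (a + ∑ j, w j * f j) + ∑ j, (c j - w j) * f j := by
      rw [add_assoc, ← Finset.sum_add_distrib]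
      simp_rw [← add_mul, add_sub_cancel]
    rw [hsum] at hqd ⊢
    refine add_mem (hle d (mem_truncatedSpan_of_mem_initialSpan hg hreg
      (add_mem ha (sum_mem fun j _ => Ideal.mul_mem_right _ _ (hw j))) ?_)) hfil
    have := (mem_restrictTotalDegree _ _ _).mp (filteredSpan_le_restrictTotalDegree hf d hfil)
    rw [← add_sub_cancel_right (a + ∑ j, w j * f j) (∑ j, (c j - w j) * f j)]
    exact (totalDegree_sub _ _).trans (max_le hqd this)

end Main

/-- Let `K` be an algebraically closed field and
`f₁, …, f_s ∈ K[x₁, …, x_m]` with `s > m`, of total degrees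
`d₁ ≥ d₂ ≥ … ≥ d_s ≥ 1`, whose leading forms have no common zero in `Kᵐ` other
than the origin.  Set `δ = (∑_{i=1}^{m+1} dᵢ) - m`.  Then for every `d ≥ δ`,
the `K`-dimension of `K[x]_{≤ d} / ⟨f⟩_d` is the same, and this common value
equals `dim_K K[x₁, …, x_m]/⟨f₁, …, f_s⟩`, which is finite. -/
theorem stmt3 {K : Type*} [Field K] [IsAlgClosed K] (m s : ℕ) (hs : m < s)
    (f : Fin s → MvPolynomial (Fin m) K) (dd : Fin s → ℕ)
    (hsorted : Antitone dd)
    (hd : ∀ i, 1 ≤ dd i)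
    (hdeg : ∀ i, (f i).totalDegree = dd i)
    (hlead : ∀ x : Fin m → K,
      (∀ i, eval x (homogeneousComponent (dd i) (f i)) = 0) → x = 0)
    (δ : ℕ) (hδ : δ = (∑ i : Fin (m + 1), dd (Fin.castLE hs i)) - m) :
    FiniteDimensional K (MvPolynomial (Fin m) K ⧸ Ideal.span (Set.range f)) ∧
    ∀ d, δ ≤ d →
      Module.finrank K
        (↥(restrictTotalDegree (Fin m) K d) ⧸
          (Submodule.span K
            {q | ∃ (i : Fin s) (p : MvPolynomial (Fin m) K),
              p.totalDegree + dd i ≤ d ∧ q = f i * p}).comap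
            (restrictTotalDegree (Fin m) K d).subtype)
        = Module.finrank K
            (MvPolynomial (Fin m) K ⧸ Ideal.span (Set.range f)) := by
  obtain ⟨e, rfl⟩ : ∃ e : ℕ → ℕ, dd = fun j : Fin s => e j :=
    ⟨fun i => if h : i < s then dd ⟨i, h⟩ else 0, by simp⟩
  have hδ' : δ = ∑ i ∈ Finset.range m, (e i - 1) + e m := by
    have h : ∑ i ∈ Finset.range m, (e i - 1) + m = ∑ i ∈ Finset.range m, e i := by
      rw [← Finset.sum_congr rfl fun i hi => Nat.sub_add_cancel
        (hd ⟨i, (Finset.mem_range.mp hi).trans hs⟩), Finset.sum_add_distrib]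
      simp
    rw [hδ, Fin.sum_univ_castSucc]
    simp only [Fin.val_castLE, Fin.val_castSucc, Fin.val_last]
    rw [Fin.sum_univ_eq_sum_range, ← h]
    omega
  have key (d : ℕ) (hδd : δ ≤ d) :
      Nonempty ((↥(restrictTotalDegree (Fin m) K d) ⧸
        (filteredSpan f e d).comap (restrictTotalDegree (Fin m) K d).subtype) ≃ₗ[K]
          (MvPolynomial (Fin m) K ⧸ (Ideal.span (Set.range f)).restrictScalars K)) := by
    obtain ⟨h1, h2⟩ := exists_sub_mem_and_mem_filteredSpan_iff hs (fun _ _ h => hsorted h) hd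
      (fun i => (hdeg i).le) hlead (hδ' ▸ hδd)
    refine ⟨quotientComapEquiv _ _ _ ?_ fun v => ?_⟩
    · ext q
      exact h2 q ((mem_restrictTotalDegree _ _ _).mp q.2)
    · obtain ⟨w, hw, h⟩ := h1 v
      exact ⟨w, hw, (mem_restrictTotalDegree _ _ _).mpr h⟩
  have hfin (d : ℕ) : FiniteDimensional K (restrictTotalDegree (Fin m) K d) := inferInstance
  refine ⟨?_, fun d hδd => (key d hδd).some.finrank_eq⟩
  exact Module.Finite.equiv (key δ le_rfl).some
end

section
/- Let K be a field, let f_1,…,f_s ∈ K[x_1,…,x_m] have total degrees d_1,…,d_s, and let f_1^h,…,f_s^h ∈ K[x_1,…,x_{m+1}] be their homogenizations with respect to a new variable x_{m+1}. For every d ≥ 0, the dehomogenization map (substituting x_{m+1} := 1) induces a K-linear isomorphism from the degree-d homogeneous component of K[x_1,…,x_{m+1}]/⟨f_1^h,…,f_s^h⟩ onto the quotient K[x]_{≤d}/⟨f⟩_d. -/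
open MvPolynomial

/-- The homogenization `f^h = x_{m+1}^{deg f} · f(x₁/x_{m+1}, …, x_m/x_{m+1})`
of a polynomial `f ∈ K[x₁, …, x_m]` with respect to a new last variable. -/
noncomputable def homogenization {K : Type*} [CommSemiring K] {m : ℕ}
    (f : MvPolynomial (Fin m) K) : MvPolynomial (Fin (m + 1)) K :=
  ∑ α ∈ f.support,
    monomial
      (Finsupp.mapDomain Fin.castSucc α +
        Finsupp.single (Fin.last m) (f.totalDegree - α.degree))
      (coeff α f)

/-- Homogenization in degree `d`: each monomial `x^α` is sent to `x^α x_{m+1}^{d - |α|}`. -/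
noncomputable def homogenizeTo (K : Type*) [CommSemiring K] (m d : ℕ) :
    MvPolynomial (Fin m) K →ₗ[K] MvPolynomial (Fin (m + 1)) K :=
  (basisMonomials (Fin m) K).constr K fun α =>
    monomial (Finsupp.mapDomain Fin.castSucc α + Finsupp.single (Fin.last m) (d - α.degree)) 1

/-- Dehomogenization, substituting `1` for the last variable. -/
noncomputable abbrev dehomogenize (K : Type*) [CommSemiring K] (m : ℕ) :
    MvPolynomial (Fin (m + 1)) K →ₐ[K] MvPolynomial (Fin m) K :=
  aeval (Fin.snoc X 1 : Fin (m + 1) → MvPolynomial (Fin m) K)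

section Homogenization

variable {K : Type*} [CommSemiring K] {m : ℕ}

theorem homogenizeTo_monomial (d : ℕ) (α : Fin m →₀ ℕ) (c : K) :
    homogenizeTo K m d (monomial α c) =
      monomial (Finsupp.mapDomain Fin.castSucc α +
        Finsupp.single (Fin.last m) (d - α.degree)) c := by
  have h : monomial α c = c • basisMonomials (Fin m) K α := by
    simp [smul_monomial]
  rw [h, map_smul, homogenizeTo, Module.Basis.constr_basis, smul_monomial, smul_eq_mul, mul_one]

theorem homogenization_eq_homogenizeTo (f : MvPolynomial (Fin m) K) :
    homogenization f = homogenizeTo K m f.totalDegree f := by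
  conv_rhs => rw [f.as_sum]
  rw [map_sum]
  simp only [homogenizeTo_monomial, ← f.as_sum, homogenization]

theorem dehomogenize_monomial (α : Fin (m + 1) →₀ ℕ) (c : K) :
    dehomogenize K m (monomial α c) =
      monomial (Finsupp.equivFunOnFinite.symm fun i => α (Fin.castSucc i)) c := by
  rw [aeval_monomial, monomial_eq, Finsupp.prod_fintype _ _ (fun _ => pow_zero _),
    Finsupp.prod_fintype _ _ (fun _ => pow_zero _), Fin.prod_univ_castSucc]
  simp [algebraMap_eq]

theorem dehomogenize_homogenizeTo (d : ℕ) (p : MvPolynomial (Fin m) K) :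
    dehomogenize K m (homogenizeTo K m d p) = p := by
  induction p using MvPolynomial.induction_on' with
  | monomial α c =>
    rw [homogenizeTo_monomial, dehomogenize_monomial]
    congr 1
    ext i
    simp [Finsupp.mapDomain_apply (Fin.castSucc_injective m)]
  | add p q hp hq => rw [map_add, map_add, hp, hq]

theorem degree_eq_degree_castSucc_add_last (α : Fin (m + 1) →₀ ℕ) :
    α.degree =
      (Finsupp.equivFunOnFinite.symm fun i => α (Fin.castSucc i)).degree + α (Fin.last m) := by
  simp [Finsupp.degree_eq_sum, Fin.sum_univ_castSucc]

theorem MvPolynomial.IsHomogeneous.homogenizeTo_dehomogenize {d : ℕ}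
    {q : MvPolynomial (Fin (m + 1)) K} (hq : q.IsHomogeneous d) :
    homogenizeTo K m d (dehomogenize K m q) = q := by
  conv_rhs => rw [q.as_sum]
  conv_lhs => rw [q.as_sum]
  rw [map_sum, map_sum]
  refine Finset.sum_congr rfl fun α hα => ?_
  have hd : α.degree = d := (hq.degree_eq_sum_deg_support hα).symm
  rw [dehomogenize_monomial, homogenizeTo_monomial, ← hd, degree_eq_degree_castSucc_add_last α,
    Nat.add_sub_cancel_left]
  congr 2
  ext i
  refine Fin.lastCases ?_ (fun j => ?_) i
  · rw [Finsupp.add_apply, Finsupp.mapDomain_of_notMem_range _ _ (by simp)]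
    simp
  · simp [Finsupp.mapDomain_apply (Fin.castSucc_injective m)]

theorem isHomogeneous_homogenizeTo {d : ℕ} {p : MvPolynomial (Fin m) K}
    (hp : p.totalDegree ≤ d) : (homogenizeTo K m d p).IsHomogeneous d := by
  rw [p.as_sum, map_sum]
  refine IsHomogeneous.sum _ _ _ fun α hα => ?_
  rw [homogenizeTo_monomial]
  refine isHomogeneous_monomial _ ?_
  have hα : α.degree ≤ d := (le_totalDegree hα).trans hp
  rw [map_add, Finsupp.degree_mapDomain, Finsupp.degree_single, Nat.add_sub_cancel' hα]

theorem MvPolynomial.IsHomogeneous.totalDegree_dehomogenize_le {d : ℕ}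
    {q : MvPolynomial (Fin (m + 1)) K} (hq : q.IsHomogeneous d) :
    (dehomogenize K m q).totalDegree ≤ d := by
  rw [q.as_sum, map_sum]
  refine totalDegree_finsetSum_le fun α hα => ?_
  rw [dehomogenize_monomial]
  refine (totalDegree_monomial_le _ _).trans ?_
  have hd : α.degree = d := (hq.degree_eq_sum_deg_support hα).symm
  rw [← hd, degree_eq_degree_castSucc_add_last α]
  exact Nat.le_add_right _ _

theorem homogenizeTo_mul {a b : ℕ} {p q : MvPolynomial (Fin m) K}
    (hp : p.totalDegree ≤ a) (hq : q.totalDegree ≤ b) :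
    homogenizeTo K m (a + b) (p * q) = homogenizeTo K m a p * homogenizeTo K m b q := by
  have h := ((isHomogeneous_homogenizeTo hp).mul
    (isHomogeneous_homogenizeTo hq)).homogenizeTo_dehomogenize
  rwa [map_mul, dehomogenize_homogenizeTo, dehomogenize_homogenizeTo] at h

theorem isHomogeneous_homogenization (f : MvPolynomial (Fin m) K) :
    (homogenization f).IsHomogeneous f.totalDegree := by
  rw [homogenization_eq_homogenizeTo]
  exact isHomogeneous_homogenizeTo le_rfl

theorem dehomogenize_homogenization (f : MvPolynomial (Fin m) K) :
    dehomogenize K m (homogenization f) = f := by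
  rw [homogenization_eq_homogenizeTo, dehomogenize_homogenizeTo]

variable (K m) in
/-- Dehomogenization identifies the homogeneous polynomials of degree `d` in `m + 1` variables
with the polynomials of total degree at most `d` in `m` variables. -/
noncomputable def dehomogenizeEquiv (d : ℕ) :
    homogeneousSubmodule (Fin (m + 1)) K d ≃ₗ[K] restrictTotalDegree (Fin m) K d :=
  LinearEquiv.ofLinearMap
    ((dehomogenize K m).toLinearMap.restrict fun _ hq =>
      (mem_restrictTotalDegree _ _ _).mpr (IsHomogeneous.totalDegree_dehomogenize_le hq))
    ((homogenizeTo K m d).restrict fun _ hp =>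
      isHomogeneous_homogenizeTo ((mem_restrictTotalDegree _ _ _).mp hp))
    (LinearMap.ext fun p => Subtype.ext (dehomogenize_homogenizeTo d p.1))
    (LinearMap.ext fun q => Subtype.ext (IsHomogeneous.homogenizeTo_dehomogenize q.2))

/-- A homogeneous multiple of a homogeneous polynomial `g` is a multiple of `g` by a homogeneous
polynomial, of the complementary degree. -/
theorem MvPolynomial.IsHomogeneous.exists_mul_eq {σ : Type*} {d k : ℕ} {g p : MvPolynomial σ K}
    (hg : g.IsHomogeneous k) (hgp : (g * p).IsHomogeneous d) :
    g * p = 0 ∨ ∃ n p', k + n = d ∧ p'.IsHomogeneous n ∧ g * p = g * p' := by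
  classical
  have hsum : g * p = ∑ n ∈ Finset.range (p.totalDegree + 1), g * homogeneousComponent n p := by
    rw [← Finset.mul_sum, sum_homogeneousComponent]
  have hcomp (n : ℕ) : homogeneousComponent d (g * homogeneousComponent n p) =
      if k + n = d then g * homogeneousComponent n p else 0 := by
    rw [homogeneousComponent_of_mem
      (hg.mul (homogeneousComponent_isHomogeneous n p))]
    simp [eq_comm]
  have hgp' : g * p = ∑ n ∈ Finset.range (p.totalDegree + 1),
      if k + n = d then g * homogeneousComponent n p else 0 := by
    have h := homogeneousComponent_of_mem (m := d) hgp
    rw [if_pos rfl] at h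
    rw [← h, hsum, map_sum]
    exact Finset.sum_congr rfl fun n _ => hcomp n
  by_cases h : ∃ n ∈ Finset.range (p.totalDegree + 1), k + n = d
  · obtain ⟨n, hn, hkn⟩ := h
    refine Or.inr ⟨n, homogeneousComponent n p, hkn, homogeneousComponent_isHomogeneous n p, ?_⟩
    rw [hgp', Finset.sum_eq_single_of_mem n hn fun j _ hj => if_neg (by omega), if_pos hkn]
  · push Not at h
    exact Or.inl (hgp'.trans (Finset.sum_eq_zero fun n hn => if_neg (h n hn)))

/-- A homogeneous polynomial lies in the degree-`d` part of the ideal of the homogenizations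
exactly when its dehomogenization is a combination of multiples of degree at most `d`. -/
theorem dehomogenize_mem_span_iff {ι : Type*} (f : ι → MvPolynomial (Fin m) K) {d : ℕ}
    {q : MvPolynomial (Fin (m + 1)) K} (hq : q.IsHomogeneous d) :
    dehomogenize K m q ∈ Submodule.span K
        {q | ∃ (i : ι) (p : MvPolynomial (Fin m) K),
          p.totalDegree + (f i).totalDegree ≤ d ∧ q = f i * p} ↔
      q ∈ Submodule.span K
        {q | q ∈ homogeneousSubmodule (Fin (m + 1)) K d ∧
          ∃ (i : ι) (p : MvPolynomial (Fin (m + 1)) K), q = homogenization (f i) * p} := by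
  constructor
  · intro h
    rw [← hq.homogenizeTo_dehomogenize, ← Submodule.mem_comap]
    revert h
    apply Submodule.span_le.mpr
    rintro _ ⟨i, p, hp, rfl⟩
    refine Submodule.subset_span ⟨isHomogeneous_homogenizeTo
      ((totalDegree_mul _ _).trans (by omega)), i,
      homogenizeTo K m (d - (f i).totalDegree) p, ?_⟩
    rw [homogenization_eq_homogenizeTo, ← homogenizeTo_mul le_rfl (by omega),
      Nat.add_sub_cancel' (by omega)]
  · intro h
    rw [← AlgHom.toLinearMap_apply, ← Submodule.mem_comap]
    revert h
    apply Submodule.span_le.mpr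
    rintro _ ⟨hd, i, p, rfl⟩
    rw [mem_homogeneousSubmodule] at hd
    obtain h0 | ⟨n, p', hn, hp', he⟩ := (isHomogeneous_homogenization (f i)).exists_mul_eq hd
    · rw [h0]
      exact zero_mem _
    · refine Submodule.subset_span ⟨i, dehomogenize K m p', ?_, ?_⟩
      · have := hp'.totalDegree_dehomogenize_le
        omega
      · rw [he, AlgHom.toLinearMap_apply, map_mul, dehomogenize_homogenization]

end Homogenization

/-- Let `K` be a field, `f₁, …, f_s ∈ K[x₁, …, x_m]` of total
degrees `d₁, …, d_s`, with homogenizations `f₁ʰ, …, f_sʰ ∈ K[x₁, …, x_{m+1}]`.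
For every `d ≥ 0`, the dehomogenization map (substituting `x_{m+1} := 1`)
induces a `K`-linear isomorphism from the degree-`d` homogeneous component of
`K[x₁, …, x_{m+1}]/⟨f₁ʰ, …, f_sʰ⟩` (the degree-`d` homogeneous polynomials
modulo the span of the degree-`d` homogeneous multiples of the `fᵢʰ`) onto the
quotient `K[x]_{≤ d} / ⟨f⟩_d`. -/
theorem stmt4 {K : Type*} [Field K] (m s : ℕ)
    (f : Fin s → MvPolynomial (Fin m) K) (dd : Fin s → ℕ)
    (hdeg : ∀ i, (f i).totalDegree = dd i)
    (d : ℕ) :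
    ∃ e :
      (↥(homogeneousSubmodule (Fin (m + 1)) K d) ⧸
        (Submodule.span K
          {q | q ∈ homogeneousSubmodule (Fin (m + 1)) K d ∧
            ∃ (i : Fin s) (p : MvPolynomial (Fin (m + 1)) K),
              q = homogenization (f i) * p}).comap
          (homogeneousSubmodule (Fin (m + 1)) K d).subtype)
      ≃ₗ[K]
      (↥(restrictTotalDegree (Fin m) K d) ⧸
        (Submodule.span K
          {q | ∃ (i : Fin s) (p : MvPolynomial (Fin m) K),
            p.totalDegree + dd i ≤ d ∧ q = f i * p}).comap
          (restrictTotalDegree (Fin m) K d).subtype),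
      ∀ (p : MvPolynomial (Fin (m + 1)) K)
        (hp : p ∈ homogeneousSubmodule (Fin (m + 1)) K d),
        ∃ hq : (aeval (Fin.snoc X 1 : Fin (m + 1) → MvPolynomial (Fin m) K)) p
            ∈ restrictTotalDegree (Fin m) K d,
          e (Submodule.Quotient.mk ⟨p, hp⟩) =
            Submodule.Quotient.mk
              ⟨(aeval (Fin.snoc X 1 : Fin (m + 1) → MvPolynomial (Fin m) K)) p, hq⟩ := by
  obtain rfl : (fun i => (f i).totalDegree) = dd := funext hdeg
  refine ⟨Submodule.Quotient.equiv _ _ (dehomogenizeEquiv K m d) ?_, fun p hp =>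
    ⟨(dehomogenizeEquiv K m d ⟨p, hp⟩).2, rfl⟩⟩
  ext y
  obtain ⟨x, rfl⟩ := (dehomogenizeEquiv K m d).surjective y
  refine Iff.trans ?_ (dehomogenize_mem_span_iff f x.2).symm
  exact (dehomogenizeEquiv K m d).injective.mem_set_image
end
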